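/- Let k be an algebraically closed field of characteristic 2 and let G = Sp(2n, k) with n ≥ 2. Then the conjugacy class of every involution of G (every element u ≠ 1 with u² = 1) is spherical. -/

import Mathlib

open scoped Matrix

section SphericalDefs

variable (G : Type*) [Group G] [TopologicalSpace G]

/-- A Borel subgroup of an algebraic group: a maximal closed connected solvable subgroup. -/
def IsBorel (B : Subgroup G) : Prop :=
  IsClosed (B : Set G) ∧ IsConnected (B : Set G) ∧ IsSolvable B ∧
    ∀ B' : Subgroup G, IsClosed (B' : Set G) → IsConnected (B' : Set G) → IsSolvable B' →
      B ≤ B' → B' = B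

variable {G}

/-- The orbit of `x` under conjugation by elements of a subgroup `B`. -/
def conjOrbit (B : Subgroup G) (x : G) : Set G := {g | ∃ b ∈ B, g = b * x * b⁻¹}

/-- The conjugacy class of `u`. -/
def conjClass (u : G) : Set G := {v | IsConj u v}

variable (G)

/-- A subset (typically a conjugacy class) of `G` is *spherical* if a Borel subgroup of `G`
has a dense orbit on it (acting by conjugation). -/
def IsSphericalClass (O : Set G) : Prop :=
  ∃ B : Subgroup G, IsBorel G B ∧ ∃ x ∈ O, O ⊆ closure (conjOrbit B x)

/-- A subgroup `H ≤ G` is a *spherical subgroup* if a Borel subgroup of `G` has a dense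
orbit on the homogeneous space `G ⧸ H`, i.e. `G ⧸ H` is a spherical homogeneous space. -/
def IsSphericalSubgroup (H : Subgroup G) : Prop :=
  ∃ B : Subgroup G, IsBorel G B ∧ ∃ x : G ⧸ H, Dense {y : G ⧸ H | ∃ b ∈ B, y = b • x}

end SphericalDefs

/-- The (classical) Zariski topology on the affine space `ι → k`:
a basis of open sets is given by the nonvanishing loci of polynomials. -/
def zariskiTopology (k : Type*) [CommRing k] (ι : Type*) : TopologicalSpace (ι → k) :=
  TopologicalSpace.generateFrom
    {s | ∃ p : MvPolynomial ι k, s = {v | MvPolynomial.eval v p ≠ 0}}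

/-- The Zariski topology on the general linear group `GL m k`, viewing it as an affine
variety via `g ↦ (g, g⁻¹)`. -/
instance glZariskiTopology (m k : Type*) [DecidableEq m] [Fintype m] [CommRing k] :
    TopologicalSpace (GL m k) :=
  TopologicalSpace.induced
    (fun g => Sum.elim (fun p : m × m => ((g : Matrix m m k)) p.1 p.2)
      (fun p : m × m => (((g⁻¹ : GL m k) : Matrix m m k)) p.1 p.2))
    (zariskiTopology k ((m × m) ⊕ (m × m)))

noncomputable section

variable (k : Type*) [Field k] (n : ℕ)

private lemma glInvVec {k : Type*} [Field k] {m : Type*} [DecidableEq m] [Fintype m]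
    (g : GL m k) (u : m → k) :
    (g : Matrix m m k) *ᵥ (((g⁻¹ : GL m k) : Matrix m m k) *ᵥ u) = u := by
  rw [Matrix.mulVec_mulVec, ← Units.val_mul, mul_inv_cancel, Units.val_one,
    Matrix.one_mulVec]

/-- The standard nondegenerate alternating bilinear form on `k^{2n}`. -/
def sympForm (v w : (Fin n ⊕ Fin n) → k) : k :=
  ∑ i : Fin n, (v (Sum.inl i) * w (Sum.inr i) - v (Sum.inr i) * w (Sum.inl i))

/-- The symplectic group `Sp(2n, k)`: the subgroup of `GL(2n, k)` preserving the
standard nondegenerate alternating bilinear form. -/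
def SpGroup : Subgroup (GL (Fin n ⊕ Fin n) k) where
  carrier := {g : GL (Fin n ⊕ Fin n) k | ∀ v w : (Fin n ⊕ Fin n) → k,
      sympForm k n ((g : Matrix (Fin n ⊕ Fin n) (Fin n ⊕ Fin n) k) *ᵥ v)
        ((g : Matrix (Fin n ⊕ Fin n) (Fin n ⊕ Fin n) k) *ᵥ w) = sympForm k n v w}
  mul_mem' := by
    intro a b ha hb v w
    simp only [Units.val_mul, ← Matrix.mulVec_mulVec]
    rw [ha, hb]
  one_mem' := by
    intro v w
    simp [Matrix.one_mulVec]
  inv_mem' := by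
    intro g hg v w
    conv_rhs => rw [← glInvVec g v, ← glInvVec g w, hg]

open scoped Pointwise Topology

section SemitopologicalGroup

variable {G : Type*} [Group G] [TopologicalSpace G] [SeparatelyContinuousMul G]

theorem IsPreirreducible.mul_of_separatelyContinuous {S T : Set G}
    (hS : IsPreirreducible S) (hT : IsPreirreducible T) : IsPreirreducible (S * T) := by
  rintro U V hU hV ⟨_, ⟨s, hs, t, ht, rfl⟩, hst⟩ ⟨_, ⟨s', hs', t', ht', rfl⟩, hst'⟩
  obtain ⟨z, hzS, hzU, hzV⟩ := hS ((· * t) ⁻¹' U) ((· * t') ⁻¹' V)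
    (hU.preimage (continuous_mul_const t)) (hV.preimage (continuous_mul_const t'))
    ⟨s, hs, hst⟩ ⟨s', hs', hst'⟩
  obtain ⟨w, hwT, hwU, hwV⟩ := hT ((z * ·) ⁻¹' U) ((z * ·) ⁻¹' V)
    (hU.preimage (continuous_const_mul z)) (hV.preimage (continuous_const_mul z))
    ⟨t, ht, hzU⟩ ⟨t', ht', hzV⟩
  exact ⟨z * w, ⟨z, hzS, w, hwT, rfl⟩, hwU, hwV⟩

theorem IsIrreducible.mul_of_separatelyContinuous {S T : Set G}
    (hS : IsIrreducible S) (hT : IsIrreducible T) : IsIrreducible (S * T) :=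
  ⟨hS.nonempty.mul hT.nonempty, hS.isPreirreducible.mul_of_separatelyContinuous hT.isPreirreducible⟩

theorem mem_irreducibleComponents_unique {X Y : Set G} (hX : X ∈ irreducibleComponents G)
    (hY : Y ∈ irreducibleComponents G) {g : G} (hgX : g ∈ X) (hgY : g ∈ Y) : X = Y := by
  have hZ : IsIrreducible (((· * g⁻¹) '' X) * Y) :=
    (hX.1.image _ (continuous_mul_const g⁻¹).continuousOn).mul_of_separatelyContinuous hY.1
  have hXZ : X ⊆ ((· * g⁻¹) '' X) * Y := fun x hx => ⟨_, ⟨x, hx, rfl⟩, g, hgY, by simp⟩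
  have hYZ : Y ⊆ ((· * g⁻¹) '' X) * Y := fun y hy => ⟨_, ⟨g, hgX, rfl⟩, y, hy, by simp⟩
  exact (hXZ.antisymm (hX.2 hZ hXZ)).trans (hYZ.antisymm (hY.2 hZ hYZ)).symm

/-- A connected semitopological group whose topology is Noetherian is irreducible. -/
theorem isIrreducible_univ_of_noetherianSpace [TopologicalSpace.NoetherianSpace G]
    [ConnectedSpace G] : IsIrreducible (Set.univ : Set G) := by
  set X := irreducibleComponent (1 : G)
  have hX : X ∈ irreducibleComponents G := irreducibleComponent_mem_irreducibleComponents 1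
  obtain ⟨o, ho, ⟨z, hz⟩, hoX⟩ :=
    TopologicalSpace.NoetherianSpace.exists_isOpen_nonempty_subset_irreducibleComponent X hX
  have hopen : IsOpen X := by
    rw [isOpen_iff_forall_mem_open]
    intro h hh
    refine ⟨((h * z⁻¹)⁻¹ * ·) ⁻¹' o, ?_, ho.preimage (continuous_const_mul _), by simpa using hz⟩
    obtain ⟨Y, hY, hXY⟩ := exists_mem_irreducibleComponents_subset_of_isIrreducible
      (((h * z⁻¹) * ·) '' X) (hX.1.image _ (continuous_const_mul _).continuousOn)
    have hYX : Y = X := mem_irreducibleComponents_unique hY hX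
      (hXY ⟨z, hoX hz, by simp⟩) hh
    intro x hx
    rw [← hYX]
    exact hXY ⟨_, hoX hx, by simp [mul_assoc]⟩
  have := IsClopen.eq_univ ⟨isClosed_irreducibleComponent, hopen⟩ ⟨1, mem_irreducibleComponent⟩
  exact this ▸ hX.1

end SemitopologicalGroup

section Zariski

variable {k : Type*} [Field k]

theorem isOpen_zariskiTopology {ι : Type*} (p : MvPolynomial ι k) :
    IsOpen[zariskiTopology k ι] {v | MvPolynomial.eval v p ≠ 0} :=
  TopologicalSpace.isOpen_generateFrom_of_mem ⟨p, rfl⟩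

theorem exists_eval_ne_zero_of_isOpen {ι : Type*} {U : Set (ι → k)}
    (hU : IsOpen[zariskiTopology k ι] U) {v : ι → k} (hv : v ∈ U) :
    ∃ p : MvPolynomial ι k, MvPolynomial.eval v p ≠ 0 ∧
      ∀ w, MvPolynomial.eval w p ≠ 0 → w ∈ U := by
  induction hU with
  | basic s hs => obtain ⟨p, rfl⟩ := hs; exact ⟨p, hv, fun _ h => h⟩
  | univ => exact ⟨1, by simp, fun _ _ => trivial⟩
  | inter s t _ _ hs ht =>
    obtain ⟨p, hp, hps⟩ := hs hv.1
    obtain ⟨q, hq, hqt⟩ := ht hv.2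
    refine ⟨p * q, by simp [hp, hq], fun w hw => ?_⟩
    rw [map_mul, mul_ne_zero_iff] at hw
    exact ⟨hps w hw.1, hqt w hw.2⟩
  | sUnion S _ ih =>
    obtain ⟨s, hs, hvs⟩ := hv
    obtain ⟨p, hp, hps⟩ := ih s hs hvs
    exact ⟨p, hp, fun w hw => ⟨s, hs, hps w hw⟩⟩

theorem isClosed_vanishing_closure {ι : Type*} {C : Set (ι → k)}
    (hC : IsClosed[zariskiTopology k ι] C) {v : ι → k}
    (hv : ∀ p ∈ MvPolynomial.vanishingIdeal k C, MvPolynomial.eval v p = 0) : v ∈ C := by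
  by_contra hvC
  obtain ⟨p, hp, hpC⟩ := exists_eval_ne_zero_of_isOpen hC.isOpen_compl hvC
  refine hp (hv p fun w hw => ?_)
  by_contra h
  exact hpC w (by simpa [MvPolynomial.aeval_eq_eval] using h) hw

theorem noetherianSpace_zariskiTopology (ι : Type*) [Finite ι] :
    @TopologicalSpace.NoetherianSpace (ι → k) (zariskiTopology k ι) := by
  let := zariskiTopology k ι
  refine ((TopologicalSpace.noetherianSpace_TFAE (ι → k)).out 0 1).2 ?_
  let f : TopologicalSpace.Closeds (ι → k) → (Ideal (MvPolynomial ι k))ᵒᵈ :=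
    fun C => OrderDual.toDual (MvPolynomial.vanishingIdeal k (C : Set (ι → k)))
  have hf : StrictMono f := by
    refine Monotone.strictMono_of_injective (fun C D h => ?_) fun C D h => ?_
    · exact MvPolynomial.vanishingIdeal_anti_mono h
    · have h' : MvPolynomial.vanishingIdeal k (C : Set (ι → k)) =
        MvPolynomial.vanishingIdeal k (D : Set (ι → k)) := h
      refine SetLike.coe_injective (Set.Subset.antisymm ?_ ?_)
      · exact fun v hv => isClosed_vanishing_closure D.isClosed fun p hp => by
          simpa [MvPolynomial.aeval_eq_eval] using (h' ▸ hp) v hv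
      · exact fun v hv => isClosed_vanishing_closure C.isClosed fun p hp => by
          simpa [MvPolynomial.aeval_eq_eval] using (h' ▸ hp) v hv
  exact hf.wellFoundedLT

end Zariski

section GeneralLinear

variable {k : Type*} [Field k] {m : Type*} [DecidableEq m] [Fintype m]

/-- The coordinates of an invertible matrix: the entries of `g` and of `g⁻¹`. -/
def glCoord (g : GL m k) : (m × m) ⊕ (m × m) → k :=
  Sum.elim (fun p : m × m => ((g : Matrix m m k)) p.1 p.2)
    (fun p : m × m => (((g⁻¹ : GL m k) : Matrix m m k)) p.1 p.2)

theorem isOpen_gl_iff {U : Set (GL m k)} :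
    IsOpen U ↔ ∃ V, IsOpen[zariskiTopology k _] V ∧ glCoord ⁻¹' V = U :=
  @isOpen_induced_iff _ _ (zariskiTopology k _) U glCoord

theorem exists_polynomial_of_isOpen {U : Set (GL m k)} (hU : IsOpen U) {g : GL m k} (hg : g ∈ U) :
    ∃ p : MvPolynomial ((m × m) ⊕ (m × m)) k, MvPolynomial.eval (glCoord g) p ≠ 0 ∧
      ∀ h, MvPolynomial.eval (glCoord h) p ≠ 0 → h ∈ U := by
  obtain ⟨V, hV, rfl⟩ := isOpen_gl_iff.1 hU
  obtain ⟨p, hp, hpV⟩ := exists_eval_ne_zero_of_isOpen hV hg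
  exact ⟨p, hp, fun h hh => hpV _ hh⟩

instance : TopologicalSpace.NoetherianSpace (GL m k) :=
  letI := zariskiTopology k ((m × m) ⊕ (m × m))
  haveI := noetherianSpace_zariskiTopology (k := k) ((m × m) ⊕ (m × m))
  Topology.IsInducing.noetherianSpace (i := (glCoord : GL m k → _)) ⟨rfl⟩

theorem eval_mem_subalgebra {X ι : Type*} (A : Subalgebra k (X → k)) {f : X → ι → k}
    (hf : ∀ i, (fun x => f x i) ∈ A) (p : MvPolynomial ι k) :
    (fun x => MvPolynomial.eval (f x) p) ∈ A := by
  induction p using MvPolynomial.induction_on with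
  | C a => simp only [MvPolynomial.eval_C]; exact A.algebraMap_mem a
  | add p q hp hq => simpa using! A.add_mem hp hq
  | mul_X p i hp => simpa using! A.mul_mem hp (hf i)

/-- The algebra of regular functions on the general linear group. -/
def glRegular (m k : Type*) [Field k] [DecidableEq m] [Fintype m] :
    Subalgebra k (GL m k → k) where
  carrier := {f | ∃ p : MvPolynomial ((m × m) ⊕ (m × m)) k,
    ∀ g, f g = MvPolynomial.eval (glCoord g) p}
  mul_mem' := by
    rintro _ _ ⟨p, hp⟩ ⟨q, hq⟩
    exact ⟨p * q, fun g => by simp [hp, hq]⟩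
  add_mem' := by
    rintro _ _ ⟨p, hp⟩ ⟨q, hq⟩
    exact ⟨p + q, fun g => by simp [hp, hq]⟩
  algebraMap_mem' a := ⟨MvPolynomial.C a, fun g => by simp⟩

theorem entry_mem_glRegular (i j : m) :
    (fun g : GL m k => (g : Matrix m m k) i j) ∈ glRegular m k :=
  ⟨MvPolynomial.X (Sum.inl (i, j)), fun g => by simp [glCoord]⟩

theorem inv_entry_mem_glRegular (i j : m) :
    (fun g : GL m k => ((g⁻¹ : GL m k) : Matrix m m k) i j) ∈ glRegular m k :=
  ⟨MvPolynomial.X (Sum.inr (i, j)), fun g => by simp [glCoord]⟩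

theorem isOpen_of_mem_glRegular {f : GL m k → k} (hf : f ∈ glRegular m k) :
    IsOpen {g | f g ≠ 0} := by
  obtain ⟨p, hp⟩ := hf
  exact isOpen_gl_iff.2 ⟨_, isOpen_zariskiTopology p, by ext g; simp [hp]⟩

/-- Entries of a product of matrices whose entries lie in a subalgebra of functions. -/
theorem mul_entry_mem {X l m n : Type*} [Fintype m] (A : Subalgebra k (X → k))
    {M : X → Matrix l m k} {N : X → Matrix m n k}
    (hM : ∀ i j, (fun x => M x i j) ∈ A) (hN : ∀ i j, (fun x => N x i j) ∈ A) (i : l) (j : n) :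
    (fun x => (M x * N x) i j) ∈ A := by
  have : (fun x => (M x * N x) i j) = ∑ l, (fun x => M x i l) * (fun x => N x l j) := by
    ext x; simp [Matrix.mul_apply]
  rw [this]
  exact A.sum_mem fun l _ => A.mul_mem (hM i l) (hN l j)

theorem det_mem {X m : Type*} [Fintype m] [DecidableEq m] (A : Subalgebra k (X → k))
    {M : X → Matrix m m k} (hM : ∀ i j, (fun x => M x i j) ∈ A) :
    (fun x => (M x).det) ∈ A := by
  have : (fun x => (M x).det) = ∑ σ : Equiv.Perm m,
      ((Equiv.Perm.sign σ : ℤ) : X → k) * ∏ i, (fun x => M x (σ i) i) := by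
    ext x; simp [Matrix.det_apply']
  rw [this]
  exact A.sum_mem fun σ _ => A.mul_mem (intCast_mem A _) (A.prod_mem fun i _ => hM _ _)

theorem continuous_gl_of_regular {φ : GL m k → GL m k}
    (h : ∀ i j, (fun g => (φ g : Matrix m m k) i j) ∈ glRegular m k)
    (h' : ∀ i j, (fun g => ((φ g)⁻¹ : GL m k).val i j) ∈ glRegular m k) : Continuous φ := by
  refine continuous_def.2 fun U hU => ?_
  rw [isOpen_iff_forall_mem_open]
  intro g hg
  obtain ⟨p, hp, hpU⟩ := exists_polynomial_of_isOpen hU hg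
  refine ⟨{x | MvPolynomial.eval (glCoord (φ x)) p ≠ 0}, fun x hx => hpU _ hx, ?_, hp⟩
  refine isOpen_of_mem_glRegular (eval_mem_subalgebra _ ?_ p)
  rintro (⟨i, j⟩ | ⟨i, j⟩)
  · exact h i j
  · exact h' i j

instance : SeparatelyContinuousMul (GL m k) where
  continuous_const_mul := by
    intro a
    refine continuous_gl_of_regular (fun i j => ?_) fun i j => ?_
    · exact mul_entry_mem _ (M := fun _ => (a : Matrix m m k))
        (fun i j => (glRegular m k).algebraMap_mem _) entry_mem_glRegular i j
    · simp only [mul_inv_rev]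
      exact mul_entry_mem _ (N := fun _ => ((a⁻¹ : GL m k) : Matrix m m k))
        inv_entry_mem_glRegular (fun i j => (glRegular m k).algebraMap_mem _) i j
  continuous_mul_const := by
    intro a
    refine continuous_gl_of_regular (fun i j => ?_) fun i j => ?_
    · exact mul_entry_mem _ (N := fun _ => (a : Matrix m m k))
        entry_mem_glRegular (fun i j => (glRegular m k).algebraMap_mem _) i j
    · simp only [mul_inv_rev]
      exact mul_entry_mem _ (M := fun _ => ((a⁻¹ : GL m k) : Matrix m m k))
        (fun i j => (glRegular m k).algebraMap_mem _) inv_entry_mem_glRegular i j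

theorem continuous_conj_gl (y : GL m k) : Continuous fun s : GL m k => s * y * s⁻¹ := by
  have hy : ∀ (y : GL m k) (i j : m),
      (fun s : GL m k => (s * y * s⁻¹ : GL m k).val i j) ∈ glRegular m k := fun y i j =>
    mul_entry_mem _ (fun i j => mul_entry_mem _ (N := fun _ => (y : Matrix m m k))
        entry_mem_glRegular (fun i j => (glRegular m k).algebraMap_mem _) i j)
      inv_entry_mem_glRegular i j
  refine continuous_gl_of_regular (hy y) fun i j => ?_
  simpa only [mul_inv_rev, inv_inv, mul_assoc] using hy y⁻¹ i j

/-- A family of invertible matrices is irreducible if its coordinates, as functions of the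
parameter, lie in a subalgebra without zero divisors. -/
theorem isPreirreducible_range_gl {X : Type*} (A : Subalgebra k (X → k))
    (hA : ∀ a ∈ A, ∀ b ∈ A, a ≠ 0 → b ≠ 0 → a * b ≠ 0) {S : Subgroup (GL m k)} {φ : X → S}
    (h : ∀ i j, (fun x => (φ x).1.val i j) ∈ A)
    (h' : ∀ i j, (fun x => ((φ x).1⁻¹ : GL m k).val i j) ∈ A) :
    IsPreirreducible (Set.range φ) := by
  have hmem : ∀ p, (fun x => MvPolynomial.eval (glCoord (φ x).1) p) ∈ A := by
    refine eval_mem_subalgebra _ ?_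
    rintro (⟨i, j⟩ | ⟨i, j⟩)
    · exact h i j
    · exact h' i j
  rintro U V hU hV ⟨_, ⟨x, rfl⟩, hx⟩ ⟨_, ⟨y, rfl⟩, hy⟩
  obtain ⟨U, hU', rfl⟩ := isOpen_induced_iff.1 hU
  obtain ⟨V, hV', rfl⟩ := isOpen_induced_iff.1 hV
  obtain ⟨p, hp, hpU⟩ := exists_polynomial_of_isOpen hU' (g := (φ x).1) hx
  obtain ⟨q, hq, hqV⟩ := exists_polynomial_of_isOpen hV' (g := (φ y).1) hy
  obtain ⟨z, hz⟩ := Function.ne_iff.1 (hA _ (hmem p) _ (hmem q)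
    (fun h => hp (congrFun h x)) (fun h => hq (congrFun h y)))
  exact ⟨φ z, ⟨z, rfl⟩, hpU _ (left_ne_zero_of_mul hz), hqV _ (right_ne_zero_of_mul hz)⟩

/-- Regular functions on the locus of affine space where a polynomial `p` does not vanish. -/
def principalRegular {ι : Type*} (p : MvPolynomial ι k) :
    Subalgebra k ({x : ι → k // MvPolynomial.eval x p ≠ 0} → k) where
  carrier := {f | ∃ (q : MvPolynomial ι k) (d : ℕ), ∀ x,
    f x * MvPolynomial.eval x.1 p ^ d = MvPolynomial.eval x.1 q}
  mul_mem' := by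
    rintro a b ⟨q, d, h⟩ ⟨q', d', h'⟩
    refine ⟨q * q', d + d', fun x => ?_⟩
    rw [map_mul, ← h, ← h', Pi.mul_apply]; ring
  add_mem' := by
    rintro a b ⟨q, d, h⟩ ⟨q', d', h'⟩
    refine ⟨q * p ^ d' + q' * p ^ d, d + d', fun x => ?_⟩
    simp only [map_add, map_mul, map_pow, ← h, ← h', Pi.add_apply]; ring
  algebraMap_mem' a := ⟨MvPolynomial.C a, 0, fun x => by simp⟩

theorem coord_mem_principalRegular {ι : Type*} (p : MvPolynomial ι k) (i : ι) :
    (fun x => x.1 i) ∈ principalRegular p := ⟨MvPolynomial.X i, 0, fun x => by simp⟩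

theorem inv_mem_principalRegular {ι : Type*} (p : MvPolynomial ι k) :
    (fun x => (MvPolynomial.eval x.1 p)⁻¹) ∈ principalRegular p :=
  ⟨1, 1, fun x => by simp [x.2]⟩

theorem principalRegular_mul_ne_zero [Infinite k] {ι : Type*} {p : MvPolynomial ι k} (hp : p ≠ 0)
    (a : _) (ha : a ∈ principalRegular p) (b : _) (hb : b ∈ principalRegular p)
    (ha0 : a ≠ 0) (hb0 : b ≠ 0) : a * b ≠ 0 := by
  obtain ⟨q, d, hq⟩ := ha
  obtain ⟨q', d', hq'⟩ := hb
  have hne : ∀ {a : {x : ι → k // MvPolynomial.eval x p ≠ 0} → k} {q : MvPolynomial ι k} {d : ℕ},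
      (∀ x, a x * MvPolynomial.eval x.1 p ^ d = MvPolynomial.eval x.1 q) → a ≠ 0 → q ≠ 0 := by
    rintro a q d hq ha0 rfl
    obtain ⟨x, hx⟩ := Function.ne_iff.1 ha0
    have := hq x
    rw [map_zero, mul_eq_zero] at this
    exact hx (this.resolve_right (pow_ne_zero _ x.2))
  have h0 : p * (q * q') ≠ 0 := mul_ne_zero hp (mul_ne_zero (hne hq ha0) (hne hq' hb0))
  obtain ⟨x, hx⟩ : ∃ x, MvPolynomial.eval x (p * (q * q')) ≠ 0 := by
    by_contra! hall
    exact h0 (MvPolynomial.funext fun x => by simpa using hall x)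
  simp only [map_mul, mul_ne_zero_iff] at hx
  refine Function.ne_iff.2 ⟨⟨x, hx.1⟩, mul_ne_zero (fun h => hx.2.1 ?_) fun h => hx.2.2 ?_⟩
  · rw [← hq ⟨x, hx.1⟩, h, zero_mul]
  · rw [← hq' ⟨x, hx.1⟩, h, zero_mul]

end GeneralLinear

section Borel

variable {k : Type*} [Field k] {m : Type*} [DecidableEq m] [Fintype m] {S : Subgroup (GL m k)}

instance {G : Type*} [Group G] [TopologicalSpace G] [SeparatelyContinuousMul G]
    (H : Subgroup G) : SeparatelyContinuousMul H :=
  inferInstanceAs (SeparatelyContinuousMul H.toSubmonoid)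

/-- The ideal of polynomials vanishing on a set of invertible matrices. -/
def coordIdeal (X : Set S) : Ideal (MvPolynomial ((m × m) ⊕ (m × m)) k) :=
  MvPolynomial.vanishingIdeal k ((fun g : S => glCoord g.1) '' X)

theorem mem_coordIdeal {X : Set S} {p : MvPolynomial ((m × m) ⊕ (m × m)) k} :
    p ∈ coordIdeal X ↔ ∀ g ∈ X, MvPolynomial.eval (glCoord g.1) p = 0 := by
  simp only [coordIdeal, MvPolynomial.mem_vanishingIdeal_iff, MvPolynomial.aeval_eq_eval,
    Set.forall_mem_image]

theorem isOpen_eval_ne_zero (p : MvPolynomial ((m × m) ⊕ (m × m)) k) :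
    IsOpen {g : S | MvPolynomial.eval (glCoord g.1) p ≠ 0} :=
  (isOpen_of_mem_glRegular ⟨p, fun _ => rfl⟩ :
    IsOpen {g : GL m k | MvPolynomial.eval (glCoord g) p ≠ 0}).preimage continuous_subtype_val

theorem subset_of_coordIdeal_le {X Y : Set S} (hY : IsClosed Y)
    (h : coordIdeal Y ≤ coordIdeal X) : X ⊆ Y := by
  intro g hg
  by_contra hgY
  obtain ⟨U, hU, hUY⟩ := isOpen_induced_iff.1 hY.isOpen_compl
  obtain ⟨p, hp, hpU⟩ := exists_polynomial_of_isOpen (g := g.1) hU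
    (by rw [← Set.mem_preimage, hUY]; exact hgY)
  refine hp (mem_coordIdeal.1 (h (mem_coordIdeal.2 fun y hy => ?_)) g hg)
  by_contra hpy
  have : y ∈ Subtype.val ⁻¹' U := hpU _ hpy
  rw [hUY] at this
  exact this hy

theorem isIrreducible_of_isConnected {H : Subgroup S} (hH : IsConnected (H : Set S)) :
    IsIrreducible (H : Set S) := by
  have : ConnectedSpace H := isConnected_iff_connectedSpace.1 hH
  have : TopologicalSpace.NoetherianSpace H :=
    Topology.IsInducing.noetherianSpace
      (Topology.IsInducing.subtypeVal.comp Topology.IsInducing.subtypeVal :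
        Topology.IsInducing (fun h : H => (h : S).1))
  simpa using! (isIrreducible_univ_of_noetherianSpace (G := H)).image _
    continuous_subtype_val.continuousOn

theorem isPrime_coordIdeal {X : Set S} (hX : IsIrreducible X) : (coordIdeal X).IsPrime := by
  refine ⟨fun h => ?_, fun {p q} hpq => ?_⟩
  · obtain ⟨g, hg⟩ := hX.nonempty
    simpa using mem_coordIdeal.1 (h ▸ Submodule.mem_top :
      (1 : MvPolynomial ((m × m) ⊕ (m × m)) k) ∈ coordIdeal X) g hg
  · by_contra! h
    simp only [mem_coordIdeal, not_forall] at h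
    obtain ⟨⟨g, hg, hgp⟩, g', hg', hgq⟩ := h
    obtain ⟨z, hz, hzp, hzq⟩ := hX.isPreirreducible _ _ (isOpen_eval_ne_zero p)
      (isOpen_eval_ne_zero q) ⟨g, hg, hgp⟩ ⟨g', hg', hgq⟩
    exact mul_ne_zero hzp hzq (by simpa using mem_coordIdeal.1 hpq z hz)

/-- Every closed connected solvable subgroup is contained in a Borel subgroup. -/
theorem exists_isBorel_ge {B₀ : Subgroup S} (hcl : IsClosed (B₀ : Set S))
    (hconn : IsConnected (B₀ : Set S)) (hsol : Group.IsSolvable B₀) :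
    ∃ B : Subgroup S, IsBorel S B ∧ B₀ ≤ B := by
  obtain ⟨B, ⟨hB₀, hBcl, hBconn, hBsol⟩, hmin⟩ := exists_minimalFor_of_wellFoundedLT
    (fun H : Subgroup S => B₀ ≤ H ∧ IsClosed (H : Set S) ∧ IsConnected (H : Set S) ∧
      Group.IsSolvable H) (fun H => (coordIdeal (H : Set S)).height)
    ⟨B₀, le_rfl, hcl, hconn, hsol⟩
  refine ⟨B, ⟨hBcl, hBconn, hBsol, fun B' hcl' hconn' hsol' hle => ?_⟩, hB₀⟩
  have hI : coordIdeal (B' : Set S) ≤ coordIdeal (B : Set S) := fun p hp =>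
    mem_coordIdeal.2 fun g hg => mem_coordIdeal.1 hp g (hle hg)
  have := isPrime_coordIdeal (isIrreducible_of_isConnected hBconn)
  have := isPrime_coordIdeal (isIrreducible_of_isConnected hconn')
  obtain hlt | heq := hI.lt_or_eq
  · have h1 := Ideal.height_strict_mono_of_isPrime_of_isPrime hlt
    exact absurd (hmin ⟨hB₀.trans hle, hcl', hconn', hsol'⟩ h1.le) h1.not_ge
  · exact le_antisymm (subset_of_coordIdeal_le hBcl heq.ge) hle

theorem isSphericalClass_of_dense_conjOrbit {B₀ : Subgroup S} (hcl : IsClosed (B₀ : Set S))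
    (hconn : IsConnected (B₀ : Set S)) (hsol : Group.IsSolvable B₀) {O : Set S} {x : S}
    (hx : x ∈ O) (hO : O ⊆ closure (conjOrbit B₀ x)) : IsSphericalClass S O := by
  obtain ⟨B, hB, hle⟩ := exists_isBorel_ge hcl hconn hsol
  exact ⟨B, hB, x, hx, hO.trans <| closure_mono fun _ ⟨b, hb, h⟩ => ⟨b, hle hb, h⟩⟩

theorem continuous_conj (y : S) : Continuous fun s : S => s * y * s⁻¹ :=
  continuous_induced_rng.2 ((continuous_conj_gl y.1).comp continuous_subtype_val)

/-- If some conjugate of `y` by an element of an irreducible set containing `1` lies in an open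
set `Ω`, then `y` is in the closure of the part in `Ω` of its conjugacy class. -/
theorem mem_closure_of_conj_mem {Z Ω T : Set S} (hZ : IsPreirreducible Z) (h1 : 1 ∈ Z)
    (hΩ : IsOpen Ω) {y : S} (hT : ∀ s : S, s * y * s⁻¹ ∈ Ω → s * y * s⁻¹ ∈ T)
    {s : S} (hs : s ∈ Z) (hsy : s * y * s⁻¹ ∈ Ω) : y ∈ closure T := by
  rw [mem_closure_iff]
  intro V hV hyV
  obtain ⟨z, -, hzV, hzΩ⟩ := hZ _ _ (hV.preimage (continuous_conj y))
    (hΩ.preimage (continuous_conj y)) ⟨1, h1, by simpa using hyV⟩ ⟨s, hs, hsy⟩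
  exact ⟨_, hzV, hT z hzΩ⟩

end Borel

section SymmetricForms

variable {k : Type*} [Field k] {n : ℕ} {R : Matrix (Fin n) (Fin n) k}

theorem toBilin'_comm (hR : R.IsSymm) (x y : Fin n → k) : R.toBilin' x y = R.toBilin' y x := by
  rw [Matrix.toBilin'_apply', Matrix.toBilin'_apply', Matrix.dotProduct_mulVec,
    ← Matrix.mulVec_transpose, hR.eq, dotProduct_comm]

/-- The Gram matrix of the first `t` vectors of `v` is the permutation matrix of `σ`. -/
def IsGramPattern (R : Matrix (Fin n) (Fin n) k) (σ : ℕ → ℕ) (v : ℕ → Fin n → k) (t : ℕ) : Prop :=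
  ∀ i < t, ∀ j < t, R.toBilin' (v i) (v j) = if σ i = j then 1 else 0

/-- Projection to the orthogonal complement of the first `t` vectors of `v`. -/
def gramProj (R : Matrix (Fin n) (Fin n) k) (σ : ℕ → ℕ) (v : ℕ → Fin n → k) (t : ℕ)
    (x : Fin n → k) : Fin n → k :=
  x - ∑ i ∈ Finset.range t, R.toBilin' (v (σ i)) x • v i

variable {σ : ℕ → ℕ} {v : ℕ → Fin n → k} {t : ℕ}

theorem toBilin'_gramProj (hσ : Function.Involutive σ) (ht : ∀ i < t, σ i < t)
    (hv : IsGramPattern R σ v t) {j : ℕ} (hj : j < t) (x : Fin n → k) :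
    R.toBilin' (v j) (gramProj R σ v t x) = 0 := by
  rw [gramProj, map_sub, map_sum, Finset.sum_eq_single_of_mem (σ j) (by simpa using ht j hj)]
  · rw [map_smul, hv j hj _ (ht j hj), hσ j]; simp
  · intro i hi hij
    rw [map_smul, hv j hj i (by simpa using hi), if_neg (Ne.symm hij), smul_zero]

theorem linearIndependent_mulVec (hσ : Function.Involutive σ) (ht : ∀ i < t, σ i < t)
    (hv : IsGramPattern R σ v t) :
    LinearIndependent k (fun i : Fin t => R *ᵥ v i) := by
  rw [Fintype.linearIndependent_iff]
  intro c hc j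
  have h1 : ∑ i : Fin t, c i * R.toBilin' (v (σ j)) (v i) = 0 := by
    have := congrArg (fun z => v (σ j) ⬝ᵥ z) hc
    simpa [dotProduct_sum, Matrix.toBilin'_apply'] using this
  rw [Finset.sum_eq_single j] at h1
  · rw [hv _ (ht _ j.2) _ j.2, hσ] at h1
    simpa using h1
  · intro i _ hij
    rw [hv _ (ht _ j.2) _ i.2, hσ, if_neg fun h => hij (Fin.ext h.symm), mul_zero]
  · simp

theorem le_rank_of_isGramPattern (hσ : Function.Involutive σ) (ht : ∀ i < t, σ i < t)
    (hv : IsGramPattern R σ v t) : t ≤ R.rank := by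
  have h : LinearIndependent k (fun i : Fin t => (⟨R *ᵥ v i, v i, rfl⟩ : R.mulVecLin.range)) :=
    LinearIndependent.of_comp R.mulVecLin.range.subtype (linearIndependent_mulVec hσ ht hv)
  simpa using! h.fintype_card_le_finrank

theorem toBilin'_eq_zero_of_rank_eq (hR : R.IsSymm) (hσ : Function.Involutive σ)
    (ht : ∀ i < t, σ i < t) (hv : IsGramPattern R σ v t) (hr : R.rank = t) {a : Fin n → k}
    (ha : ∀ i < t, R.toBilin' (v i) a = 0) (b : Fin n → k) : R.toBilin' a b = 0 := by
  have hspan : Submodule.span k (Set.range fun i : Fin t => R *ᵥ v i) = R.mulVecLin.range := by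
    refine Submodule.eq_of_le_of_finrank_eq ?_ ?_
    · rw [Submodule.span_le]
      rintro _ ⟨i, rfl⟩
      exact ⟨v i, rfl⟩
    · rw [finrank_span_eq_card (linearIndependent_mulVec hσ ht hv), Fintype.card_fin]
      exact hr.symm
  have hb : R *ᵥ b ∈ Submodule.span k (Set.range fun i : Fin t => R *ᵥ v i) :=
    hspan ▸ ⟨b, rfl⟩
  obtain ⟨c, hc⟩ := (Submodule.mem_span_range_iff_exists_fun k).1 hb
  rw [Matrix.toBilin'_apply', ← hc, dotProduct_sum]
  refine Finset.sum_eq_zero fun i _ => ?_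
  rw [dotProduct_smul, ← Matrix.toBilin'_apply', toBilin'_comm hR, ha i i.2, smul_zero]

theorem exists_toBilin'_ne_zero_of_lt_rank (hσ : Function.Involutive σ)
    (ht : ∀ i < t, σ i < t) (hv : IsGramPattern R σ v t) (hr : t < R.rank) :
    ∃ a b : Fin n → k, (∀ i < t, R.toBilin' (v i) a = 0) ∧ (∀ i < t, R.toBilin' (v i) b = 0) ∧
      R.toBilin' a b ≠ 0 := by
  by_contra! h
  refine hr.not_ge ?_
  have hle : R.mulVecLin.range ≤ Submodule.span k (Set.range fun i : Fin t => R *ᵥ v i) := by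
    rintro _ ⟨x, rfl⟩
    have hx : R *ᵥ gramProj R σ v t x = 0 := by
      refine dotProduct_eq_zero _ fun y => ?_
      have hy : y = gramProj R σ v t y + ∑ i ∈ Finset.range t, R.toBilin' (v (σ i)) y • v i := by
        simp [gramProj]
      rw [dotProduct_comm, ← Matrix.toBilin'_apply', hy, map_add, LinearMap.add_apply, map_sum,
        LinearMap.sum_apply, h _ _ (fun i hi => toBilin'_gramProj hσ ht hv hi y)
          (fun i hi => toBilin'_gramProj hσ ht hv hi x), zero_add]
      refine Finset.sum_eq_zero fun i hi => ?_
      rw [map_smul, LinearMap.smul_apply,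
        toBilin'_gramProj hσ ht hv (Finset.mem_range.1 hi), smul_zero]
    rw [gramProj, Matrix.mulVec_sub, sub_eq_zero, Matrix.mulVec_sum] at hx
    rw [Matrix.mulVecLin_apply, hx]
    refine Submodule.sum_mem _ fun i hi => ?_
    rw [Matrix.mulVec_smul]
    exact Submodule.smul_mem _ _ (Submodule.subset_span ⟨⟨i, Finset.mem_range.1 hi⟩, rfl⟩)
  calc R.rank ≤ _ := Submodule.finrank_mono hle
    _ ≤ _ := finrank_range_le_card _
    _ = t := Fintype.card_fin t

open scoped Classical in
/-- `σ = id` for nonalternating forms and the product of the transpositions `(2i, 2i+1)` for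
alternating ones. -/
def formPairing (alt : Prop) (i : ℕ) : ℕ :=
  if alt then (if i % 2 = 0 then i + 1 else i - 1) else i

theorem formPairing_true (i : ℕ) :
    formPairing True i = if i % 2 = 0 then i + 1 else i - 1 := if_pos trivial

theorem formPairing_false : formPairing False = id := funext fun _ => if_neg id

theorem formPairing_involutive (alt : Prop) : Function.Involutive (formPairing alt) := by
  intro i
  by_cases h : alt
  · obtain rfl := eq_true h
    grind [formPairing_true]
  · obtain rfl := eq_false h
    simp [formPairing_false]

theorem forall_formPairing_true_lt_iff {t : ℕ} :
    (∀ i < t, formPairing True i < t) ↔ t % 2 = 0 := by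
  refine ⟨fun h => ?_, fun h i hi => ?_⟩
  · by_contra h2
    have := h (t - 1) (by omega)
    rw [formPairing_true, if_pos (by omega)] at this
    omega
  · rw [formPairing_true]
    split <;> omega

theorem IsGramPattern.extend_one (hR : R.IsSymm) (hv : IsGramPattern R id v t) {u : Fin n → k}
    (hvu : ∀ i < t, R.toBilin' (v i) u = 0) (huu : R.toBilin' u u = 1) :
    IsGramPattern R id (Function.update v t u) (t + 1) := by
  intro i hi j hj
  rcases Nat.lt_succ_iff_lt_or_eq.1 hi with hi | rfl <;>
  rcases Nat.lt_succ_iff_lt_or_eq.1 hj with hj | rfl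
  · rw [Function.update_of_ne hi.ne, Function.update_of_ne hj.ne, hv i hi j hj]
  · rw [Function.update_of_ne hi.ne, Function.update_self, hvu i hi, id, if_neg hi.ne]
  · rw [Function.update_of_ne hj.ne, Function.update_self, toBilin'_comm hR, hvu j hj, id,
      if_neg hj.ne']
  · simp [huu]

theorem IsGramPattern.extend_two (hR : R.IsSymm) (hv : IsGramPattern R (formPairing True) v t)
    (ht : t % 2 = 0) {a b : Fin n → k} (ha : ∀ i < t, R.toBilin' (v i) a = 0)
    (hb : ∀ i < t, R.toBilin' (v i) b = 0) (haa : R.toBilin' a a = 0) (hbb : R.toBilin' b b = 0)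
    (hab : R.toBilin' a b = 1) :
    IsGramPattern R (formPairing True) (Function.update (Function.update v t a) (t + 1) b)
      (t + 2) := by
  have hcases : ∀ i < t + 2, i < t ∨ i = t ∨ i = t + 1 := by omega
  have hlt : ∀ i < t, Function.update (Function.update v t a) (t + 1) b i = v i := fun i hi => by
    rw [Function.update_of_ne (by omega), Function.update_of_ne hi.ne]
  have h0 : Function.update (Function.update v t a) (t + 1) b t = a := by
    rw [Function.update_of_ne (by omega), Function.update_self]
  have hp := forall_formPairing_true_lt_iff.2 ht
  have hp0 : formPairing True t = t + 1 := by rw [formPairing_true, if_pos ht]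
  have hp1 : formPairing True (t + 1) = t := by rw [← hp0, formPairing_involutive]
  intro i hi j hj
  rcases hcases i hi with hi | rfl | rfl <;> rcases hcases j hj with hj | rfl | rfl
  · rw [hlt i hi, hlt j hj, hv i hi j hj]
  · rw [hlt i hi, h0, ha i hi, if_neg (hp i hi).ne]
  · rw [hlt i hi, Function.update_self, hb i hi, if_neg (by have := hp i hi; omega)]
  · rw [hlt j hj, h0, toBilin'_comm hR, ha j hj, if_neg (by omega)]
  · rw [h0, haa, if_neg (by omega)]
  · rw [h0, Function.update_self, hab, if_pos hp0]
  · rw [hlt j hj, Function.update_self, toBilin'_comm hR, hb j hj, if_neg (by omega)]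
  · rw [h0, Function.update_self, toBilin'_comm hR, hab, if_pos hp1]
  · rw [Function.update_self, hbb, if_neg (by omega)]

theorem exists_isGramPattern_of_nonalternating [CharP k 2] [IsAlgClosed k] (hR : R.IsSymm)
    (h : ∃ x, R.toBilin' x x ≠ 0) (t : ℕ) (ht : t ≤ R.rank) :
    ∃ v, IsGramPattern R id v t ∧
      (t < R.rank → ∃ w, (∀ i < t, R.toBilin' (v i) w = 0) ∧ R.toBilin' w w ≠ 0) := by
  induction t with
  | zero => exact ⟨0, fun i hi => absurd hi (Nat.not_lt_zero i), fun _ => h.imp fun x hx =>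
      ⟨fun i hi => absurd hi (Nat.not_lt_zero i), hx⟩⟩
  | succ t ih =>
    obtain ⟨v, hv, hw⟩ := ih (by omega)
    obtain ⟨w, hvw, hww⟩ := hw (by omega)
    obtain ⟨c, hc⟩ := IsAlgClosed.exists_pow_nat_eq (R.toBilin' w w) two_pos
    have hc0 : c ≠ 0 := by rintro rfl; exact hww (by rw [← hc]; simp)
    obtain ⟨u, hvu, huu⟩ : ∃ u, (∀ i < t, R.toBilin' (v i) u = 0) ∧ R.toBilin' u u = 1 := by
      refine ⟨c⁻¹ • w, fun i hi => by simp [hvw i hi], ?_⟩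
      simp only [map_smul, LinearMap.smul_apply, ← hc, smul_eq_mul]
      field_simp
    have hv1 := hv.extend_one hR hvu huu
    by_cases hex : t + 1 < R.rank → ∃ w,
        (∀ i < t + 1, R.toBilin' (Function.update v t u i) w = 0) ∧ R.toBilin' w w ≠ 0
    · exact ⟨_, hv1, hex⟩
    push Not at hex
    obtain ⟨hlt, hex⟩ := hex
    obtain ⟨a, b, ha, hb, hab⟩ := exists_toBilin'_ne_zero_of_lt_rank
      (fun _ => rfl) (fun i hi => hi) hv1 hlt
    have ha' : ∀ i < t, R.toBilin' (v i) a = 0 := fun i hi => by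
      simpa [Function.update_of_ne hi.ne] using ha i (by omega)
    have hb' : ∀ i < t, R.toBilin' (v i) b = 0 := fun i hi => by
      simpa [Function.update_of_ne hi.ne] using hb i (by omega)
    have hua : R.toBilin' u a = 0 := by simpa using ha t (by omega)
    have hub : R.toBilin' u b = 0 := by simpa using hb t (by omega)
    have haa := hex a ha
    have hbb := hex b hb
    refine ⟨_, hv.extend_one hR (u := u + a) (fun i hi => by simp [hvu i hi, ha' i hi]) ?_,
      fun _ => ⟨u + (R.toBilin' a b)⁻¹ • b, fun i hi => ?_, ?_⟩⟩
    · simp [huu, hua, haa, toBilin'_comm hR a u]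
    · rcases Nat.lt_succ_iff_lt_or_eq.1 hi with hi | rfl
      · simp [Function.update_of_ne hi.ne, hvu i hi, hb' i hi]
      · simp [huu, hub, toBilin'_comm hR a u, hua, hab, CharTwo.add_self_eq_zero]
    · simp [huu, hub, hbb, toBilin'_comm hR b u]

theorem exists_isGramPattern_of_alternating (hR : R.IsSymm)
    (h : ∀ x, R.toBilin' x x = 0) (s : ℕ) (hs : 2 * s < R.rank + 2) :
    ∃ v, IsGramPattern R (formPairing True) v (2 * s) := by
  induction s with
  | zero => exact ⟨0, fun i hi => absurd hi (Nat.not_lt_zero i)⟩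
  | succ s ih =>
    obtain ⟨v, hv⟩ := ih (by omega)
    obtain ⟨a, b, ha, hb, hab⟩ := exists_toBilin'_ne_zero_of_lt_rank
      (formPairing_involutive True) (forall_formPairing_true_lt_iff.2 (by simp)) hv (by omega)
    exact ⟨_, hv.extend_two hR (by simp) ha (b := (R.toBilin' a b)⁻¹ • b)
      (fun i hi => by simp [hb i hi]) (h _) (h _) (by simp [hab])⟩

/-- A symmetric form over an algebraically closed field of characteristic two is determined up
to equivalence by its rank and by whether it is alternating. -/
theorem exists_isGramPattern [CharP k 2] [IsAlgClosed k] (hR : R.IsSymm) {alt : Prop}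
    (halt : (∀ x, R.toBilin' x x = 0) ↔ alt) :
    (∀ i < R.rank, formPairing alt i < R.rank) ∧
      ∃ v, IsGramPattern R (formPairing alt) v R.rank := by
  by_cases h : alt
  · obtain rfl := eq_true h
    obtain ⟨v, hv⟩ := exists_isGramPattern_of_alternating hR (halt.2 trivial)
      ((R.rank + 1) / 2) (by omega)
    have := le_rank_of_isGramPattern (formPairing_involutive True)
      (forall_formPairing_true_lt_iff.2 (by simp)) hv
    have heq : R.rank = 2 * ((R.rank + 1) / 2) := by omega
    refine ⟨forall_formPairing_true_lt_iff.2 (by omega), v, ?_⟩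
    rwa [heq]
  · obtain rfl := eq_false h
    rw [formPairing_false]
    obtain ⟨v, hv, -⟩ := exists_isGramPattern_of_nonalternating hR
      (by simpa using halt) R.rank le_rfl
    exact ⟨fun i hi => hi, v, hv⟩

end SymmetricForms

section LeadingMinors

variable {k : Type*} [Field k] {n : ℕ}

/-- The leading principal minor of size `t` (of size `n` if `t ≥ n`). -/
def leadingMinor {S : Type*} [CommRing S] (t : ℕ) (M : Matrix (Fin n) (Fin n) S) : S :=
  (M.toSquareBlockProp fun i => (i : ℕ) < t).det

theorem map_leadingMinor {S T : Type*} [CommRing S] [CommRing T] (f : S →+* T) (t : ℕ)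
    (M : Matrix (Fin n) (Fin n) S) : f (leadingMinor t M) = leadingMinor t (M.map f) := by
  rw [leadingMinor, RingHom.map_det]; rfl

theorem transpose_mul_mul_of_apply (R : Matrix (Fin n) (Fin n) k) (v : ℕ → Fin n → k)
    (i j : Fin n) :
    ((Matrix.of fun i (j : Fin n) => v j i)ᵀ * R * (Matrix.of fun i (j : Fin n) => v j i)) i j =
      R.toBilin' (v i) (v j) := by
  rw [Matrix.toBilin'_apply', Matrix.dotProduct_mulVec]
  rfl

theorem leadingMinor_ne_zero_of_isGramPattern {R : Matrix (Fin n) (Fin n) k} {σ : ℕ → ℕ}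
    {v : ℕ → Fin n → k} {r t : ℕ} (hσ : Function.Involutive σ) (hv : IsGramPattern R σ v r)
    (hr : r ≤ n) (htr : t ≤ r) (ht : ∀ i < t, σ i < t) :
    leadingMinor t ((Matrix.of fun i (j : Fin n) => v j i)ᵀ * R *
      (Matrix.of fun i (j : Fin n) => v j i)) ≠ 0 := by
  set P := (((Matrix.of fun i (j : Fin n) => v j i)ᵀ * R *
    (Matrix.of fun i (j : Fin n) => v j i)).toSquareBlockProp fun i => (i : ℕ) < t) with hP
  have hPa : ∀ i j, P i j = if σ i = j then 1 else 0 := fun i j => by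
    rw [hP, Matrix.toSquareBlockProp_def, Matrix.of_apply, transpose_mul_mul_of_apply,
      hv _ (i.2.trans_le htr) _ (j.2.trans_le htr)]
  have hPP : P * P = 1 := by
    ext i j
    let l : {i : Fin n // (i : ℕ) < t} :=
      ⟨⟨σ i, (ht i i.2).trans_le (htr.trans hr)⟩, ht i i.2⟩
    rw [Matrix.mul_apply, Finset.sum_eq_single l]
    · rw [hPa, hPa, if_pos rfl, one_mul, Matrix.one_apply]
      have : σ l = i := hσ i
      simp only [this, Subtype.ext_iff, Fin.ext_iff]
    · intro b _ hb
      rw [hPa, if_neg, zero_mul]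
      exact fun h => hb (Subtype.ext (Fin.ext h.symm))
    · simp
  intro h0
  have h1 := congrArg Matrix.det hPP
  rw [Matrix.det_mul, show P.det = 0 from h0] at h1
  simp at h1

theorem exists_det_ne_zero_of_leadingMinor [Infinite k] (R A₀ : Matrix (Fin n) (Fin n) k)
    (T : Finset ℕ) (hT : ∀ t ∈ T, leadingMinor t (A₀ᵀ * R * A₀) ≠ 0) :
    ∃ A : Matrix (Fin n) (Fin n) k, A.det ≠ 0 ∧ ∀ t ∈ T, leadingMinor t (Aᵀ * R * A) ≠ 0 := by
  open Polynomial in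
  let M : Matrix (Fin n) (Fin n) k[X] := A₀.map C + (X : k[X]) • 1
  have hM : ∀ c, M.map (Polynomial.evalRingHom c) = A₀ + c • 1 := by
    intro c
    ext i j
    by_cases h : i = j <;> simp [M, h]
  let p := fun t => leadingMinor t (Mᵀ * R.map Polynomial.C * M)
  have hp : ∀ t c, (p t).eval c = leadingMinor t ((A₀ + c • 1)ᵀ * R * (A₀ + c • 1)) := by
    intro t c
    have h1 := map_leadingMinor (Polynomial.evalRingHom c) t (Mᵀ * R.map Polynomial.C * M)
    rw [Matrix.map_mul, Matrix.map_mul, Matrix.transpose_map, hM] at h1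
    rw [← Polynomial.coe_evalRingHom]
    convert h1
    ext i j
    simp
  have hdet : M.det ≠ 0 := by
    have : M.det = (-A₀).charpoly := by
      rw [Matrix.charpoly, Matrix.charmatrix]
      congr 1
      ext i j
      by_cases h : i = j <;> simp [M, h, add_comm]
    rw [this]
    exact (Matrix.charpoly_monic _).ne_zero
  have hprod : M.det * ∏ t ∈ T, p t ≠ 0 := by
    refine mul_ne_zero hdet (Finset.prod_ne_zero_iff.2 fun t ht h0 => hT t ht ?_)
    have := hp t 0
    rw [h0] at this
    simpa using this.symm
  obtain ⟨c, hc⟩ : ∃ c, (M.det * ∏ t ∈ T, p t).eval c ≠ 0 := by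
    by_contra! hall
    exact hprod (Polynomial.funext fun x => by simpa using hall x)
  rw [Polynomial.eval_mul, Polynomial.eval_prod, mul_ne_zero_iff, Finset.prod_ne_zero_iff] at hc
  refine ⟨A₀ + c • 1, ?_, fun t ht => hp t c ▸ hc.2 t ht⟩
  rw [← hM, ← RingHom.mapMatrix_apply, ← RingHom.map_det]
  exact hc.1

/-- The matrix of the restriction of the permutation `σ` to the first `r` indices. -/
def pairingMatrix (k : Type*) [Field k] (n : ℕ) (σ : ℕ → ℕ) (r : ℕ) : Matrix (Fin n) (Fin n) k :=
  Matrix.of fun i j => if (i : ℕ) < r ∧ σ i = j then 1 else 0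

/-- All leading principal minors of size at most `r` stable under `σ` are nonzero. -/
def HasLeadingMinors (σ : ℕ → ℕ) (r : ℕ) (R : Matrix (Fin n) (Fin n) k) : Prop :=
  ∀ t ≤ r, (∀ i < t, σ i < t) → leadingMinor t R ≠ 0

theorem exists_hasLeadingMinors [CharP k 2] [IsAlgClosed k] {R : Matrix (Fin n) (Fin n) k}
    (hR : R.IsSymm) {alt : Prop} (halt : (∀ x, R.toBilin' x x = 0) ↔ alt) :
    ∃ A : Matrix (Fin n) (Fin n) k, A.det ≠ 0 ∧
      HasLeadingMinors (formPairing alt) R.rank (Aᵀ * R * A) := by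
  classical
  obtain ⟨-, v, hv⟩ := exists_isGramPattern hR halt
  have := IsAlgClosed.instInfinite (K := k)
  obtain ⟨A, hA, h⟩ := exists_det_ne_zero_of_leadingMinor R _
    {t ∈ Finset.range (R.rank + 1) | ∀ i < t, formPairing alt i < t}
    (fun t ht => leadingMinor_ne_zero_of_isGramPattern (formPairing_involutive alt) hv
      (R.rank_le_card_height.trans_eq (Fintype.card_fin n))
      (Nat.lt_succ_iff.1 (Finset.mem_range.1 (Finset.mem_filter.1 ht).1))
      (Finset.mem_filter.1 ht).2)
  exact ⟨A, hA, fun t htr ht => h t (by simpa [Nat.lt_succ_iff, htr] using ht)⟩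

theorem eq_zero_of_leadingMinor_ne_zero {R : Matrix (Fin n) (Fin n) k} {t : ℕ}
    (ht : leadingMinor t R ≠ 0) {w : Fin n → k} (hw : ∀ l : Fin n, t ≤ l → w l = 0)
    (hRw : ∀ i : Fin n, (i : ℕ) < t → (R *ᵥ w) i = 0) : w = 0 := by
  have h0 : (fun i : {i : Fin n // (i : ℕ) < t} => w i) = 0 := by
    refine Matrix.eq_zero_of_mulVec_eq_zero ht ?_
    ext i
    have := hRw i i.2
    rw [Matrix.mulVec, dotProduct, ← Fintype.sum_subtype_add_sum_subtype
      (fun l : Fin n => (l : ℕ) < t)] at this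
    rw [Finset.sum_eq_zero (s := (Finset.univ : Finset {l : Fin n // ¬ (l : ℕ) < t})), add_zero]
      at this
    · exact this
    · intro l _
      rw [hw l (not_lt.1 l.2), mul_zero]
  ext i
  by_cases hi : (i : ℕ) < t
  · exact congrFun h0 ⟨i, hi⟩
  · exact hw i (not_lt.1 hi)

/-- The first `t` vectors of `v` are the columns of an upper triangular matrix with nonzero
diagonal entries. -/
def IsTriangularFamily (v : ℕ → Fin n → k) (t : ℕ) : Prop :=
  ∀ i : Fin n, (i : ℕ) < t → v i i ≠ 0 ∧ ∀ l, i < l → v i l = 0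

section IsTriangularFamily

variable {v : ℕ → Fin n → k} {t : ℕ}

theorem IsTriangularFamily.eq_zero (hv : IsTriangularFamily v t) {z : Fin n → k}
    (hz : ∀ i < t, v i ⬝ᵥ z = 0) (i : Fin n) (hi : (i : ℕ) < t) : z i = 0 := by
  induction i using WellFoundedLT.induction with
  | ind i ih =>
    have h := hz i hi
    rw [dotProduct, Finset.sum_eq_single i] at h
    · exact (mul_eq_zero.1 h).resolve_left (hv i hi).1
    · intro l _ hl
      rcases lt_or_gt_of_ne hl with hl | hl
      · rw [ih l hl ((Fin.lt_def.1 hl).trans hi), mul_zero]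
      · rw [(hv i hi).2 l hl, zero_mul]
    · simp

theorem IsTriangularFamily.update (hv : IsTriangularFamily v t) (p : Fin n) (hp : (p : ℕ) = t)
    {w : Fin n → k} (hwp : w p ≠ 0) (hw : ∀ l, p < l → w l = 0) :
    IsTriangularFamily (Function.update v t w) (t + 1) := by
  intro i hi
  rcases Nat.lt_succ_iff_lt_or_eq.1 hi with hi | hi
  · rw [Function.update_of_ne hi.ne]
    exact hv i hi
  · obtain rfl := Fin.ext (hi.trans hp.symm)
    rw [hi, Function.update_self]
    exact ⟨hwp, hw⟩

theorem IsTriangularFamily.gramProj_single (hv : IsTriangularFamily v t)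
    (R : Matrix (Fin n) (Fin n) k) (σ : ℕ → ℕ) {p : Fin n} (hp : t ≤ p) :
    gramProj R σ v t (Pi.single p 1) p = 1 ∧
      ∀ l, p < l → gramProj R σ v t (Pi.single p 1) l = 0 := by
  have h : ∀ l : Fin n, t ≤ l →
      (∑ i ∈ Finset.range t, R.toBilin' (v (σ i)) (Pi.single p 1) • v i) l = 0 := by
    intro l hl
    rw [Finset.sum_apply]
    refine Finset.sum_eq_zero fun i hi => ?_
    have hi := Finset.mem_range.1 hi
    have := (hv ⟨i, hi.trans (hl.trans_lt l.2)⟩ hi).2 l (Fin.lt_def.2 (hi.trans_le hl))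
    simp only at this
    simp [this]
  refine ⟨?_, fun l hl => ?_⟩
  · rw [gramProj, Pi.sub_apply, h p hp]; simp
  · rw [gramProj, Pi.sub_apply, h l (hp.trans (Fin.le_def.1 hl.le))]; simp [hl.ne']

end IsTriangularFamily

variable {R : Matrix (Fin n) (Fin n) k}

theorem exists_triangular_gramPattern_of_nonalternating [IsAlgClosed k] (hR : R.IsSymm) {r : ℕ}
    (hr : r ≤ n) (hlead : HasLeadingMinors id r R) (t : ℕ) (ht : t ≤ r) :
    ∃ v, IsTriangularFamily v t ∧ IsGramPattern R id v t := by
  induction t with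
  | zero => exact ⟨0, fun i hi => absurd hi (Nat.not_lt_zero _),
      fun i hi => absurd hi (Nat.not_lt_zero i)⟩
  | succ t ih =>
    obtain ⟨v, hv, hvR⟩ := ih (by omega)
    let p : Fin n := ⟨t, by omega⟩
    obtain ⟨hwp, hw⟩ := hv.gramProj_single R id (p := p) le_rfl
    have hvw := fun i (hi : i < t) =>
      toBilin'_gramProj (σ := id) (fun _ => rfl) (fun _ h => h) hvR hi
      (Pi.single p 1)
    set w := gramProj R id v t (Pi.single p 1)
    have hww : R.toBilin' w w ≠ 0 := by
      intro h0
      have hflag := hv.update p rfl (hwp.trans_ne one_ne_zero) hw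
      have hw0 : w = 0 := by
        refine eq_zero_of_leadingMinor_ne_zero (hlead (t + 1) ht fun _ h => h) hw
          (hflag.eq_zero fun i hi => ?_)
        rw [← Matrix.toBilin'_apply']
        rcases Nat.lt_succ_iff_lt_or_eq.1 hi with hi | rfl
        · rw [Function.update_of_ne hi.ne, hvw i hi]
        · rw [Function.update_self, h0]
      rw [hw0] at hwp
      exact zero_ne_one hwp
    obtain ⟨c, hc⟩ := IsAlgClosed.exists_pow_nat_eq (R.toBilin' w w) two_pos
    have hc0 : c ≠ 0 := by rintro rfl; exact hww (by rw [← hc]; simp)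
    refine ⟨_, hv.update p rfl (w := c⁻¹ • w) (by simp [hwp, hc0]) fun l hl => by simp [hw l hl],
      hvR.extend_one hR (fun i hi => by simp [hvw i hi]) ?_⟩
    simp only [map_smul, LinearMap.smul_apply, ← hc, smul_eq_mul]
    field_simp

theorem exists_triangular_gramPattern_of_alternating (hR : R.IsSymm)
    (h : ∀ x, R.toBilin' x x = 0) {r : ℕ} (hr : r ≤ n)
    (hlead : HasLeadingMinors (formPairing True) r R) (s : ℕ) (hs : 2 * s ≤ r) :
    ∃ v, IsTriangularFamily v (2 * s) ∧ IsGramPattern R (formPairing True) v (2 * s) := by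
  induction s with
  | zero => exact ⟨0, fun i hi => absurd hi (Nat.not_lt_zero _),
      fun i hi => absurd hi (Nat.not_lt_zero i)⟩
  | succ s ih =>
    obtain ⟨v, hv, hvR⟩ := ih (by omega)
    have hσ := forall_formPairing_true_lt_iff.2 (Nat.mul_mod_right 2 s)
    rw [mul_add, mul_one] at hs ⊢
    generalize 2 * s = t at *
    let p : Fin n := ⟨t, by omega⟩
    let q : Fin n := ⟨t + 1, by omega⟩
    obtain ⟨hwp, hw⟩ := hv.gramProj_single R (formPairing True) (p := p) le_rfl
    obtain ⟨hwq, hw'⟩ := hv.gramProj_single R (formPairing True) (p := q) (Nat.le_succ t)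
    have hvw := fun i (hi : i < t) x => toBilin'_gramProj (formPairing_involutive True) hσ hvR hi x
    have hvp := fun i hi => hvw i hi (Pi.single p 1)
    have hvq := fun i hi => hvw i hi (Pi.single q 1)
    set w := gramProj R (formPairing True) v t (Pi.single p 1)
    set w' := gramProj R (formPairing True) v t (Pi.single q 1)
    have hww : R.toBilin' w w' ≠ 0 := by
      intro h0
      have hflag := (hv.update p rfl (hwp.trans_ne one_ne_zero) hw).update q rfl
        (hwq.trans_ne one_ne_zero) hw'
      have hw0 : w = 0 := by
        refine eq_zero_of_leadingMinor_ne_zero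
          (hlead (t + 2) hs (forall_formPairing_true_lt_iff.2 ?_))
          (fun l hl => hw l (Fin.lt_def.2 (Nat.lt_of_succ_lt hl)))
          (hflag.eq_zero fun i hi => ?_)
        · have := forall_formPairing_true_lt_iff.1 hσ
          omega
        · rw [← Matrix.toBilin'_apply']
          obtain hi | rfl | rfl : i < t ∨ i = t ∨ i = t + 1 := by omega
          · rw [Function.update_of_ne (by omega), Function.update_of_ne hi.ne, hvp i hi]
          · rw [Function.update_of_ne (by omega), Function.update_self, h]
          · rw [Function.update_self, toBilin'_comm hR, h0]
      rw [hw0] at hwp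
      exact zero_ne_one hwp
    refine ⟨_, (hv.update p rfl (hwp.trans_ne one_ne_zero) hw).update q rfl
      (w := (R.toBilin' w w')⁻¹ • w') (by simp [hwq, hww]) (fun l hl => by simp [hw' l hl]),
      hvR.extend_two hR (forall_formPairing_true_lt_iff.1 hσ) hvp
        (fun i hi => by simp [hvq i hi]) (h _) (h _) (by simp [hww])⟩

theorem exists_triangular_gramPattern [CharP k 2] [IsAlgClosed k] (hR : R.IsSymm) {alt : Prop}
    (halt : (∀ x, R.toBilin' x x = 0) ↔ alt)
    (hlead : HasLeadingMinors (formPairing alt) R.rank R) :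
    ∃ v, IsTriangularFamily v R.rank ∧ IsGramPattern R (formPairing alt) v R.rank := by
  have hr : R.rank ≤ n := R.rank_le_card_height.trans_eq (Fintype.card_fin n)
  have hpair := (exists_isGramPattern hR halt).1
  by_cases h : alt
  · obtain rfl := eq_true h
    have := forall_formPairing_true_lt_iff.1 hpair
    have heq : R.rank = 2 * (R.rank / 2) := by omega
    have := exists_triangular_gramPattern_of_alternating hR (halt.2 trivial) hr hlead
      (R.rank / 2) heq.ge
    rwa [← heq] at this
  · obtain rfl := eq_false h
    rw [formPairing_false] at hlead ⊢
    exact exists_triangular_gramPattern_of_nonalternating hR hr hlead _ le_rfl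

/-- A symmetric matrix over an algebraically closed field of characteristic two whose relevant
leading principal minors are nonzero is reduced to normal form by an upper triangular congruence. -/
theorem exists_blockTriangular_congr_pairingMatrix [CharP k 2] [IsAlgClosed k] (hR : R.IsSymm)
    {alt : Prop} (halt : (∀ x, R.toBilin' x x = 0) ↔ alt)
    (hlead : HasLeadingMinors (formPairing alt) R.rank R) :
    ∃ A : Matrix (Fin n) (Fin n) k, A.BlockTriangular id ∧ A.det ≠ 0 ∧
      Aᵀ * R * A = pairingMatrix k n (formPairing alt) R.rank := by
  obtain ⟨v, hv, hvR⟩ := exists_triangular_gramPattern hR halt hlead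
  have hσ := formPairing_involutive alt
  have ht := (exists_isGramPattern hR halt).1
  set r := R.rank with hr
  let e : ℕ → Fin n → k := fun j i => if (i : ℕ) = j then 1 else 0
  have he : ∀ j : Fin n, e j = Pi.single j 1 := fun j => by
    ext i
    simp [e, Pi.single_apply, Fin.ext_iff]
  let u : ℕ → Fin n → k := fun j => if j < r then v j else gramProj R (formPairing alt) v r (e j)
  have hu : IsTriangularFamily u n := by
    intro i _
    by_cases hi : (i : ℕ) < r
    · simpa [u, hi] using hv i hi
    · obtain ⟨h1, h2⟩ := hv.gramProj_single R (formPairing alt) (not_lt.1 hi)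
      simp only [u, hi, if_false, he]
      exact ⟨h1.trans_ne one_ne_zero, h2⟩
  have htri : (Matrix.of fun i (j : Fin n) => u j i).BlockTriangular id :=
    fun i j hij => (hu j j.2).2 i hij
  refine ⟨_, htri, ?_, ?_⟩
  · rw [Matrix.det_of_isUpperTriangular htri]
    exact Finset.prod_ne_zero_iff.2 fun i _ => (hu i i.2).1
  · ext i j
    rw [transpose_mul_mul_of_apply, pairingMatrix, Matrix.of_apply]
    have hproj := fun i (hi : i < r) x => toBilin'_gramProj hσ ht hvR hi x
    by_cases hi : (i : ℕ) < r
    · by_cases hj : (j : ℕ) < r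
      · simp only [u, hi, hj, if_true, true_and]
        exact hvR i hi j hj
      · simp only [u, hi, hj, if_true, if_false, true_and]
        rw [hproj i hi, if_neg fun h => hj (by rw [← h]; exact ht i hi)]
    · simp only [u, hi, if_false, false_and]
      exact toBilin'_eq_zero_of_rank_eq hR hσ ht hvR hr.symm (fun l hl => hproj l hl _) _

end LeadingMinors

section TriangularGroup

open scoped commutatorElement

variable {k : Type*} [Field k] {m : Type*}

/-- Matrices whose entries vanish below the `d`-th diagonal, with respect to `b`. -/
def triangularFiltration (k : Type*) [Field k] {m : Type*} (b : m → ℕ) (d : ℕ) :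
    Submodule k (Matrix m m k) where
  carrier := {M | ∀ i j, b j < b i + d → M i j = 0}
  add_mem' hM hN i j hij := by rw [Matrix.add_apply, hM i j hij, hN i j hij, add_zero]
  zero_mem' _ _ _ := rfl
  smul_mem' c M hM i j hij := by rw [Matrix.smul_apply, hM i j hij, smul_zero]

variable {b : m → ℕ}

theorem triangularFiltration_anti {d e : ℕ} (h : d ≤ e) :
    triangularFiltration k b e ≤ triangularFiltration k b d :=
  fun _ hM i j hij => hM i j (by omega)

theorem mem_triangularFiltration_zero {M : Matrix m m k} :
    M ∈ triangularFiltration k b 0 ↔ M.BlockTriangular b :=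
  ⟨fun h i j hij => h i j hij, fun h _ _ hij => h hij⟩

variable [Fintype m]

theorem mul_mem_triangularFiltration {d e : ℕ} {M N : Matrix m m k}
    (hM : M ∈ triangularFiltration k b d) (hN : N ∈ triangularFiltration k b e) :
    M * N ∈ triangularFiltration k b (d + e) := by
  intro i j hij
  rw [Matrix.mul_apply]
  refine Finset.sum_eq_zero fun l _ => ?_
  by_cases hl : b l < b i + d
  · rw [hM i l hl, zero_mul]
  · rw [hN l j (by omega), mul_zero]

theorem commutator_mem_triangularFiltration (hb : Function.Injective b) {d : ℕ}
    {M N : Matrix m m k} (hM : M ∈ triangularFiltration k b d)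
    (hN : N ∈ triangularFiltration k b d) : M * N - N * M ∈ triangularFiltration k b (d + 1) := by
  rcases Nat.eq_zero_or_pos d with rfl | hd
  · have diag : ∀ {M N : Matrix m m k}, M ∈ triangularFiltration k b 0 →
        N ∈ triangularFiltration k b 0 → ∀ i, (M * N) i i = M i i * N i i := by
      intro M N hM hN i
      rw [Matrix.mul_apply, Finset.sum_eq_single i]
      · intro l _ hl
        rcases lt_or_gt_of_ne (hb.ne hl) with h | h
        · rw [hM i l h, zero_mul]
        · rw [hN l i h, mul_zero]
      · simp
    intro i j hij
    rcases Nat.lt_succ_iff_lt_or_eq.1 hij with h | h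
    · exact Submodule.sub_mem _ (mul_mem_triangularFiltration hM hN)
        (mul_mem_triangularFiltration hN hM) i j h
    · obtain rfl := hb h
      rw [Matrix.sub_apply, diag hM hN, diag hN hM, mul_comm, sub_self]
  · exact triangularFiltration_anti (by omega) (Submodule.sub_mem _
      (mul_mem_triangularFiltration hM hN) (mul_mem_triangularFiltration hN hM))

variable [DecidableEq m]

theorem inv_blockTriangular {g : GL m k} (hg : g.val.BlockTriangular b) :
    g⁻¹.val.BlockTriangular b := by
  rw [Matrix.coe_units_inv]
  have := Matrix.invertibleOfIsUnitDet _ ((Matrix.isUnit_iff_isUnit_det _).1 g.isUnit)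
  exact Matrix.blockTriangular_inv_of_blockTriangular hg

/-- The group of triangular matrices congruent to `1` modulo the `d`-th filtration step. -/
def triangularSubgroup (k : Type*) [Field k] {m : Type*} [Fintype m] [DecidableEq m]
    (b : m → ℕ) (d : ℕ) : Subgroup (GL m k) where
  carrier := {g | g.val.BlockTriangular b ∧ g.val - 1 ∈ triangularFiltration k b d}
  mul_mem' {g h} hg hh := by
    refine ⟨hg.1.mul hh.1, ?_⟩
    have : (g * h).val - 1 = (g.val - 1) * h.val + (h.val - 1) := by
      rw [Units.val_mul]; noncomm_ring
    rw [this]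
    exact Submodule.add_mem _
      (mul_mem_triangularFiltration hg.2 (mem_triangularFiltration_zero.2 hh.1)) hh.2
  one_mem' := ⟨Matrix.blockTriangular_one, by simp⟩
  inv_mem' {g} hg := by
    refine ⟨inv_blockTriangular hg.1, ?_⟩
    have : g⁻¹.val - 1 = -((g.val - 1) * g⁻¹.val) := by
      rw [sub_mul, ← Units.val_mul, mul_inv_cancel]; simp
    rw [this]
    exact Submodule.neg_mem _ (mul_mem_triangularFiltration hg.2
      (mem_triangularFiltration_zero.2 (inv_blockTriangular hg.1)))

theorem mem_triangularSubgroup_zero {g : GL m k} :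
    g ∈ triangularSubgroup k b 0 ↔ g.val.BlockTriangular b :=
  ⟨fun h => h.1, fun h => ⟨h, Submodule.sub_mem _ (mem_triangularFiltration_zero.2 h)
    (mem_triangularFiltration_zero.2 Matrix.blockTriangular_one)⟩⟩

theorem commutator_triangularSubgroup_le (hb : Function.Injective b) (d : ℕ) :
    ⁅triangularSubgroup k b d, triangularSubgroup k b d⁆ ≤ triangularSubgroup k b (d + 1) := by
  rw [Subgroup.commutator_le]
  intro g hg h hh
  have hgh : (h * g)⁻¹.val.BlockTriangular b := inv_blockTriangular (hh.1.mul hg.1)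
  refine ⟨?_, ?_⟩
  · rw [commutatorElement_def]
    exact ((hg.1.mul hh.1).mul (inv_blockTriangular hg.1)).mul (inv_blockTriangular hh.1)
  · have h1 : ⁅g, h⁆.val - 1 = (g.val * h.val - h.val * g.val) * (h * g)⁻¹.val := by
      rw [sub_mul, ← Units.val_mul, ← Units.val_mul, ← Units.val_mul, ← Units.val_mul,
        mul_inv_cancel, commutatorElement_def, mul_inv_rev, Units.val_one]
      simp only [mul_assoc]
    have h2 : g.val * h.val - h.val * g.val =
        (g.val - 1) * (h.val - 1) - (h.val - 1) * (g.val - 1) := by noncomm_ring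
    rw [h1, h2]
    exact mul_mem_triangularFiltration (e := 0) (commutator_mem_triangularFiltration hb hg.2 hh.2)
      (mem_triangularFiltration_zero.2 hgh)

theorem isSolvable_triangularSubgroup (hb : Function.Injective b) :
    Group.IsSolvable (triangularSubgroup k b 0) := by
  have hD : ∀ d, (derivedSeries (triangularSubgroup k b 0) d).map
      (triangularSubgroup k b 0).subtype ≤ triangularSubgroup k b d := by
    intro d
    induction d with
    | zero => rintro _ ⟨g, -, rfl⟩; exact g.2
    | succ d ih =>
      rw [derivedSeries_succ, Subgroup.map_commutator]
      exact (Subgroup.commutator_mono ih ih).trans (commutator_triangularSubgroup_le hb d)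
  refine (Group.isSolvable_def _).2 ⟨∑ i, b i + 1, (Subgroup.eq_bot_iff_forall _).2 fun g hg => ?_⟩
  have h := (hD _ ⟨g, hg, rfl⟩).2
  refine Subtype.ext (Units.ext (sub_eq_zero.1 ?_))
  ext i j
  refine h i j ?_
  have := Finset.single_le_sum (f := b) (fun i _ => Nat.zero_le _) (Finset.mem_univ j)
  omega

end TriangularGroup

theorem inv_entry_mem {k : Type*} [Field k] {X m : Type*} [Fintype m] [DecidableEq m]
    (A : Subalgebra k (X → k)) {M : X → Matrix m m k} (hM : ∀ i j, (fun x => M x i j) ∈ A)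
    (hdet : (fun x => (M x).det⁻¹) ∈ A) (i j : m) : (fun x => (M x)⁻¹ i j) ∈ A := by
  have : (fun x => (M x)⁻¹ i j) =
      (fun x => (M x).det⁻¹) * fun x => ((M x).updateRow j (Pi.single i 1)).det := by
    ext x
    simp [Matrix.inv_def, Matrix.adjugate_apply]
  rw [this]
  refine A.mul_mem hdet (det_mem A fun i' j' => ?_)
  by_cases h : i' = j
  · subst h
    simp only [Matrix.updateRow_self]
    exact A.algebraMap_mem ((Pi.single i 1 : m → k) j')
  · simpa [Matrix.updateRow_ne h] using! hM i' j'

theorem fromBlocks_entry_mem {k : Type*} [Field k] {X l m n o : Type*}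
    (A : Subalgebra k (X → k)) {M : X → Matrix n l k} {N : X → Matrix n m k}
    {P : X → Matrix o l k} {Q : X → Matrix o m k} (hM : ∀ i j, (fun x => M x i j) ∈ A)
    (hN : ∀ i j, (fun x => N x i j) ∈ A) (hP : ∀ i j, (fun x => P x i j) ∈ A)
    (hQ : ∀ i j, (fun x => Q x i j) ∈ A) :
    ∀ i j, (fun x => Matrix.fromBlocks (M x) (N x) (P x) (Q x) i j) ∈ A := by
  rintro (i | i) (j | j)
  exacts [hM i j, hN i j, hP i j, hQ i j]

section Symplectic

open Matrix

variable {n : ℕ}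

/-- The symmetric matrix whose entries above and on the diagonal are given by `x`. -/
def symmOfFun {α : Type*} (x : Fin n × Fin n → α) : Matrix (Fin n) (Fin n) α :=
  of fun i j => x (min i j, max i j)

theorem symmOfFun_isSymm {α : Type*} (x : Fin n × Fin n → α) : (symmOfFun x).IsSymm := by
  ext i j
  simp [symmOfFun, min_comm, max_comm]

theorem symmOfFun_eq {α : Type*} {X : Matrix (Fin n) (Fin n) α} (hX : X.IsSymm) :
    symmOfFun (fun p => X p.1 p.2) = X := by
  ext i j
  rcases le_total i j with h | h
  · simp [symmOfFun, h]
  · simp [symmOfFun, h, hX.apply]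

variable {k : Type*} [Field k]

theorem sympForm_eq_dotProduct (v w : Fin n ⊕ Fin n → k) :
    sympForm k n v w = -(v ⬝ᵥ J (Fin n) k *ᵥ w) := by
  simp [sympForm, J, dotProduct, mulVec, Fintype.sum_sum_type, fromBlocks, Matrix.one_apply,
    Finset.sum_add_distrib, sub_eq_add_neg, add_comm]

theorem mem_SpGroup_iff {g : GL (Fin n ⊕ Fin n) k} :
    g ∈ SpGroup k n ↔ g.valᵀ * J (Fin n) k * g.val = J (Fin n) k := by
  have h : ∀ v w, sympForm k n (g.val *ᵥ v) (g.val *ᵥ w) =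
      -(v ⬝ᵥ (g.valᵀ * J (Fin n) k * g.val) *ᵥ w) := fun v w => by
    rw [sympForm_eq_dotProduct, ← mulVec_mulVec, ← mulVec_mulVec, dotProduct_mulVec v,
      vecMul_transpose]
  refine ⟨fun hg => ?_, fun hg v w => by rw [h, hg, sympForm_eq_dotProduct]⟩
  ext i j
  have := hg (Pi.single i 1) (Pi.single j 1)
  rw [h, sympForm_eq_dotProduct, neg_inj] at this
  simpa using this

/-- The symplectic group element with the given matrix and inverse. -/
def spOfMatrix (M M' : Matrix (Fin n ⊕ Fin n) (Fin n ⊕ Fin n) k) (h : M * M' = 1)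
    (hJ : Mᵀ * J (Fin n) k * M = J (Fin n) k) : SpGroup k n :=
  ⟨⟨M, M', h, mul_eq_one_comm.1 h⟩, mem_SpGroup_iff.2 hJ⟩

/-- The block diagonal symplectic matrix with blocks `A` and `A⁻ᵀ`. -/
def levi (A : GL (Fin n) k) : SpGroup k n :=
  spOfMatrix (fromBlocks A.val 0 0 (A⁻¹).valᵀ) (fromBlocks (A⁻¹).val 0 0 A.valᵀ)
    (by simp [fromBlocks_multiply, ← transpose_mul, -coe_units_inv])
    (by simp [J, fromBlocks_multiply, fromBlocks_transpose, ← transpose_mul, -coe_units_inv])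

/-- The symplectic matrix with diagonal blocks `1`, upper right block `X` and lower left block
`0`. -/
def upperUnipotent (X : Matrix (Fin n) (Fin n) k) (hX : X.IsSymm) : SpGroup k n :=
  spOfMatrix (fromBlocks 1 X 0 1) (fromBlocks 1 (-X) 0 1)
    (by simp [fromBlocks_multiply])
    (by simp [J, fromBlocks_multiply, fromBlocks_transpose, hX.eq])

/-- The symplectic matrix with diagonal blocks `1`, upper right block `0` and lower left block
`X`. -/
def lowerUnipotent (X : Matrix (Fin n) (Fin n) k) (hX : X.IsSymm) : SpGroup k n :=
  spOfMatrix (fromBlocks 1 0 X 1) (fromBlocks 1 0 (-X) 1)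
    (by simp [fromBlocks_multiply])
    (by simp [J, fromBlocks_multiply, fromBlocks_transpose, hX.eq])

/-- The position of a coordinate in the order that makes upper triangular symplectic matrices a
Borel subgroup. -/
def spOrder (n : ℕ) : Fin n ⊕ Fin n → ℕ :=
  Sum.elim (fun i => i) fun i => 2 * n - 1 - i

theorem spOrder_injective : Function.Injective (spOrder n) := by
  rintro (i | i) (j | j) h <;> simp only [spOrder, Sum.elim_inl, Sum.elim_inr] at h
  · exact congrArg _ (Fin.ext h)
  · omega
  · omega
  · exact congrArg _ (Fin.ext (by omega))

/-- The subgroup of symplectic matrices that are triangular with respect to `spOrder`. -/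
def spBorel (k : Type*) [Field k] (n : ℕ) : Subgroup (SpGroup k n) :=
  (triangularSubgroup k (spOrder n) 0).subgroupOf (SpGroup k n)

theorem mem_spBorel {g : SpGroup k n} : g ∈ spBorel k n ↔ g.1.val.BlockTriangular (spOrder n) :=
  mem_triangularSubgroup_zero

theorem isSolvable_spBorel : Group.IsSolvable (spBorel k n) := by
  have := isSolvable_triangularSubgroup (k := k) (spOrder_injective (n := n))
  exact Group.isSolvable_of_isSolvable_injective
    (f := ((SpGroup k n).subtype.comp (spBorel k n).subtype).codRestrict
      (triangularSubgroup k (spOrder n) 0) fun g => g.2)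
    fun g h hgh => Subtype.ext (Subtype.ext (congrArg (fun x => x.1) hgh))

theorem isClosed_spBorel : IsClosed (spBorel k n : Set (SpGroup k n)) := by
  have : (spBorel k n : Set (SpGroup k n)) = ⋂ (i) (j) (_ : spOrder n j < spOrder n i),
      {g | g.1.val i j = 0} := by
    ext g
    simp [mem_spBorel, BlockTriangular]
  rw [this]
  refine isClosed_iInter fun i => isClosed_iInter fun j => isClosed_iInter fun _ => ⟨?_⟩
  exact (isOpen_of_mem_glRegular (entry_mem_glRegular i j)).preimage continuous_subtype_val

theorem fromBlocks_blockTriangular_spOrder {a b c d : Matrix (Fin n) (Fin n) k} :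
    (fromBlocks a b c d).BlockTriangular (spOrder n) ↔
      a.BlockTriangular id ∧ c = 0 ∧ d.BlockTriangular OrderDual.toDual := by
  refine ⟨fun h => ⟨fun i j hij => ?_, ?_, fun i j hij => ?_⟩, ?_⟩
  · exact @h (Sum.inl i) (Sum.inl j) hij
  · ext i j
    exact @h (Sum.inr i) (Sum.inl j) (by simp only [spOrder, Sum.elim_inl, Sum.elim_inr]; omega)
  · have : i < j := hij
    exact @h (Sum.inr i) (Sum.inr j) (by simp only [spOrder, Sum.elim_inr]; omega)
  · rintro ⟨ha, rfl, hd⟩ (i | i) (j | j) hij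
    · exact ha hij
    · simp only [spOrder, Sum.elim_inl, Sum.elim_inr] at hij; omega
    · rfl
    · have : i < j := by simp only [spOrder, Sum.elim_inr] at hij; omega
      exact hd (OrderDual.toDual_lt_toDual.2 this)

theorem levi_mem_spBorel {A : GL (Fin n) k} (hA : A.val.BlockTriangular id) :
    levi A ∈ spBorel k n :=
  mem_spBorel.2 (fromBlocks_blockTriangular_spOrder.2
    ⟨hA, rfl, (inv_blockTriangular hA).transpose⟩)

theorem upperUnipotent_mem_spBorel {X : Matrix (Fin n) (Fin n) k} (hX : X.IsSymm) :
    upperUnipotent X hX ∈ spBorel k n :=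
  mem_spBorel.2 (fromBlocks_blockTriangular_spOrder.2
    ⟨blockTriangular_one, rfl, blockTriangular_one⟩)

theorem exists_eq_levi_mul_upperUnipotent {g : SpGroup k n} (hg : g ∈ spBorel k n) :
    ∃ (A : GL (Fin n) k) (X : Matrix (Fin n) (Fin n) k) (hX : X.IsSymm), A.val.BlockTriangular id ∧
      g = levi A * upperUnipotent X hX := by
  obtain ⟨g, hgS⟩ := g
  have hJ := mem_SpGroup_iff.1 hgS
  have hT : g.val.BlockTriangular (spOrder n) := mem_spBorel.1 hg
  obtain ⟨a, b, c, d, habcd⟩ : ∃ a b c d, g.val = fromBlocks a b c d :=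
    ⟨_, _, _, _, (fromBlocks_toBlocks g.val).symm⟩
  rw [habcd, fromBlocks_blockTriangular_spOrder] at hT
  obtain ⟨ha, rfl, -⟩ := hT
  simp only [habcd, J, fromBlocks_transpose, fromBlocks_multiply, fromBlocks_inj] at hJ
  obtain ⟨-, -, h1, h2⟩ := hJ
  simp only [mul_zero, mul_one, add_zero, zero_add, mul_neg, neg_mul] at h1 h2
  have hA : a * dᵀ = 1 := mul_eq_one_comm.1 h1
  have hX : (dᵀ * b).IsSymm := by
    rw [IsSymm, transpose_mul, transpose_transpose]
    exact (sub_eq_zero.1 ((sub_eq_add_neg _ _).trans h2)).symm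
  refine ⟨⟨a, dᵀ, hA, h1⟩, dᵀ * b, hX, ha, Subtype.ext (Units.ext ?_)⟩
  rw [habcd]
  simp [levi, upperUnipotent, spOfMatrix, fromBlocks_multiply, ← Matrix.mul_assoc, hA]

theorem levi_mul_upperUnipotent_val (A : GL (Fin n) k) {X : Matrix (Fin n) (Fin n) k}
    (hX : X.IsSymm) : (levi A * upperUnipotent X hX).1.val =
      fromBlocks A.val (A.val * X) 0 (A⁻¹).valᵀ := by
  simp [levi, upperUnipotent, spOfMatrix, fromBlocks_multiply]

theorem levi_mul_upperUnipotent_inv_val (A : GL (Fin n) k) {X : Matrix (Fin n) (Fin n) k}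
    (hX : X.IsSymm) : ((levi A * upperUnipotent X hX).1⁻¹ : GL _ k).val =
      fromBlocks (A⁻¹).val (-(X * A.valᵀ)) 0 A.valᵀ := by
  rw [Subgroup.coe_mul, _root_.mul_inv_rev]
  simp [levi, upperUnipotent, spOfMatrix, fromBlocks_multiply, Units.inv_mk, -coe_units_inv]

/-- The product of the diagonal coordinates of a matrix, as a polynomial in the entries. -/
def diagPoly (k : Type*) [Field k] (n : ℕ) :
    MvPolynomial ((Fin n × Fin n) ⊕ (Fin n × Fin n)) k :=
  ∏ i, MvPolynomial.X (Sum.inl (i, i))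

/-- The upper triangular matrix whose entries above and on the diagonal are given by `x`. -/
def triangularOfFun (x : (Fin n × Fin n) ⊕ (Fin n × Fin n) → k) : Matrix (Fin n) (Fin n) k :=
  of fun i j => if j < i then 0 else x (Sum.inl (i, j))

theorem triangularOfFun_blockTriangular (x : (Fin n × Fin n) ⊕ (Fin n × Fin n) → k) :
    (triangularOfFun x).BlockTriangular id :=
  fun _ _ h => if_pos h

theorem det_triangularOfFun (x : (Fin n × Fin n) ⊕ (Fin n × Fin n) → k) :
    (triangularOfFun x).det = MvPolynomial.eval x (diagPoly k n) := by
  rw [det_of_isUpperTriangular (triangularOfFun_blockTriangular x)]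
  simp [triangularOfFun, diagPoly]

theorem isConnected_spBorel [Infinite k] : IsConnected (spBorel k n : Set (SpGroup k n)) := by
  refine ⟨⟨1, one_mem _⟩, IsPreirreducible.isPreconnected ?_⟩
  let A : {x // MvPolynomial.eval x (diagPoly k n) ≠ 0} → GL (Fin n) k := fun x =>
    GeneralLinearGroup.mkOfDetNeZero (triangularOfFun x.1) (by rw [det_triangularOfFun]; exact x.2)
  let φ : {x // MvPolynomial.eval x (diagPoly k n) ≠ 0} → SpGroup k n := fun x =>
    levi (A x) * upperUnipotent (symmOfFun (x.1 ∘ Sum.inr)) (symmOfFun_isSymm _)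
  have hφ : (spBorel k n : Set (SpGroup k n)) = Set.range φ := by
    ext g
    constructor
    · intro hg
      obtain ⟨B, X, hX, hB, rfl⟩ := exists_eq_levi_mul_upperUnipotent hg
      have hx : triangularOfFun (Sum.elim (fun p => B.val p.1 p.2) fun p => X p.1 p.2) = B.val := by
        ext i j
        by_cases h : j < i
        · simpa [triangularOfFun, h] using (hB h).symm
        · simp [triangularOfFun, h]
      refine ⟨⟨Sum.elim (fun p => B.val p.1 p.2) fun p => X p.1 p.2, ?_⟩, ?_⟩
      · rw [← det_triangularOfFun, hx]
        exact ((isUnit_iff_isUnit_det _).1 B.isUnit).ne_zero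
      · have h1 : A ⟨Sum.elim (fun p => B.val p.1 p.2) fun p => X p.1 p.2, by
            rw [← det_triangularOfFun, hx]
            exact ((isUnit_iff_isUnit_det _).1 B.isUnit).ne_zero⟩ = B := Units.ext hx
        refine Subtype.ext (Units.ext ?_)
        simp only [φ, h1, levi_mul_upperUnipotent_val, Sum.elim_comp_inr, symmOfFun_eq hX]
    · rintro ⟨x, rfl⟩
      exact mul_mem (levi_mem_spBorel (triangularOfFun_blockTriangular x.1))
        (upperUnipotent_mem_spBorel _)
  have hp : diagPoly k n ≠ 0 := Finset.prod_ne_zero_iff.2 fun i _ => MvPolynomial.X_ne_zero _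
  have hA : ∀ i j, (fun x => (A x).val i j) ∈ principalRegular (diagPoly k n) := by
    intro i j
    by_cases h : j < i
    · convert (principalRegular (diagPoly k n)).zero_mem with x
      exact if_pos h
    · simpa [A, GeneralLinearGroup.mkOfDetNeZero, triangularOfFun, h] using!
        coord_mem_principalRegular (diagPoly k n) (Sum.inl (i, j))
  have hA' : ∀ i j, (fun x => (A x)⁻¹.val i j) ∈ principalRegular (diagPoly k n) := by
    intro i j
    simp only [coe_units_inv]
    refine inv_entry_mem _ hA ?_ i j
    convert inv_mem_principalRegular (diagPoly k n) using 2 with x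
    exact congrArg _ (det_triangularOfFun x.1)
  have hX : ∀ i j, (fun x : {x // MvPolynomial.eval x (diagPoly k n) ≠ 0} =>
      symmOfFun (x.1 ∘ Sum.inr) i j) ∈ principalRegular (diagPoly k n) :=
    fun i j => coord_mem_principalRegular _ _
  rw [hφ]
  refine isPreirreducible_range_gl _ (principalRegular_mul_ne_zero hp) ?_ ?_
  · simp only [φ, levi_mul_upperUnipotent_val]
    exact fromBlocks_entry_mem _ hA (mul_entry_mem _ hA hX) (fun _ _ => zero_mem _)
      fun i j => hA' j i
  · simp only [φ, levi_mul_upperUnipotent_inv_val]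
    exact fromBlocks_entry_mem _ hA'
      (fun i j => neg_mem (mul_entry_mem _ hX (fun i j => hA j i) i j)) (fun _ _ => zero_mem _)
      fun i j => hA j i

end Symplectic

section MatrixRank

variable {k : Type*} [Field k]

theorem Matrix.exists_eq_mul_of_rank_le {l m o : Type*} [Fintype m] [Fintype o]
    [Finite l] {M : Matrix l m k} {C : Matrix m o k} (h : M.rank ≤ (M * C).rank) :
    ∃ Z : Matrix o m k, M = M * C * Z := by
  classical
  have hle : LinearMap.range (M * C).mulVecLin ≤ LinearMap.range M.mulVecLin := by
    rw [Matrix.mulVecLin_mul]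
    exact LinearMap.range_comp_le_range _ _
  have heq := Submodule.eq_of_le_of_finrank_le hle h
  have hcol : ∀ j, ∃ z, (M * C) *ᵥ z = M.col j := fun j => by
    have : M.col j ∈ LinearMap.range (M * C).mulVecLin :=
      heq ▸ ⟨Pi.single j 1, by simp⟩
    exact this
  choose z hz using hcol
  refine ⟨Matrix.of fun i j => z j i, ?_⟩
  ext i j
  exact (congrFun (hz j) i).symm

variable {n : ℕ}

theorem le_rank_of_leadingMinor_ne_zero {R : Matrix (Fin n) (Fin n) k} {r : ℕ} (hr : r ≤ n)
    (h : leadingMinor r R ≠ 0) : r ≤ R.rank := by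
  have h1 := Matrix.rank_of_det_ne_zero h
  have h2 : Fintype.card {i : Fin n // (i : ℕ) < r} = r := by
    rw [Fintype.card_subtype, Fin.card_filter_val_lt, min_eq_right hr]
  rw [← h2, ← h1]
  exact Matrix.rank_submatrix_le _ _ _

variable [CharP k 2]

theorem Matrix.add_self_of_charTwo {l m : Type*} (M : Matrix l m k) : M + M = 0 := by
  ext; exact CharTwo.add_self_eq_zero _

theorem Matrix.neg_of_charTwo {l m : Type*} (M : Matrix l m k) : -M = M := by
  ext; exact CharTwo.neg_eq _

end MatrixRank

section PairingMatrix

variable {k : Type*} [Field k] {n r : ℕ} {σ : ℕ → ℕ}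

theorem pairingMatrix_isSymm (hσ : Function.Involutive σ) (hr : ∀ i < r, σ i < r) :
    (pairingMatrix k n σ r).IsSymm := by
  ext i j
  simp only [Matrix.transpose_apply, pairingMatrix, Matrix.of_apply]
  refine if_congr ⟨fun h => ?_, fun h => ?_⟩ rfl rfl
  · exact ⟨h.2 ▸ hr _ h.1, by rw [← h.2, hσ]⟩
  · exact ⟨h.2 ▸ hr _ h.1, by rw [← h.2, hσ]⟩

theorem pairingMatrix_mul_mul_self (hσ : Function.Involutive σ) (hr : ∀ i < r, σ i < r) 
    (hrn : r ≤ n) :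
    pairingMatrix k n σ r * pairingMatrix k n σ r * pairingMatrix k n σ r =
      pairingMatrix k n σ r := by
  have h2 : pairingMatrix k n σ r * pairingMatrix k n σ r =
      Matrix.diagonal fun i : Fin n => if (i : ℕ) < r then 1 else 0 := by
    ext i j
    rw [Matrix.mul_apply, Matrix.diagonal_apply]
    by_cases hi : (i : ℕ) < r
    · rw [Finset.sum_eq_single ⟨σ i, (hr i hi).trans_le hrn⟩]
      · simp [pairingMatrix, hi, hr i hi, hσ (i : ℕ), Fin.ext_iff]
      · intro l _ hl
        rw [pairingMatrix, Matrix.of_apply, if_neg, zero_mul]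
        rintro ⟨-, h⟩
        exact hl (Fin.ext h.symm)
      · simp
    · simp [pairingMatrix, hi]
  rw [h2]
  ext i j
  rw [Matrix.diagonal_mul]
  by_cases hi : (i : ℕ) < r <;> simp [pairingMatrix, hi]

end PairingMatrix

section Involution

open Matrix

variable {k : Type*} [Field k] {n : ℕ}

/-- The lower left block of a symplectic matrix. -/
def lowerLeft (y : SpGroup k n) : Matrix (Fin n) (Fin n) k := y.1.val.toBlocks₂₁

theorem conj_sub_one (s y : SpGroup k n) :
    (s * y * s⁻¹).1.val - 1 = s.1.val * (y.1.val - 1) * (s⁻¹).1.val := by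
  have : s.1.val * (s⁻¹).1.val = 1 := by
    rw [← Units.val_mul, ← Subgroup.coe_mul, mul_inv_cancel]; rfl
  rw [mul_sub, sub_mul, mul_one, this]
  simp only [Subgroup.coe_mul, Units.val_mul]

theorem rank_mul_SpGroup {m : Type*} (M : Matrix m (Fin n ⊕ Fin n) k) (s : SpGroup k n) :
    (M * s.1.val).rank = M.rank :=
  rank_mul_eq_left_of_isUnit_det _ _ ((isUnit_iff_isUnit_det _).1 s.1.isUnit)

theorem rank_SpGroup_mul {m : Type*} [Fintype m] (M : Matrix (Fin n ⊕ Fin n) m k)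
    (s : SpGroup k n) : (s.1.val * M).rank = M.rank :=
  rank_mul_eq_right_of_isUnit_det _ _ ((isUnit_iff_isUnit_det _).1 s.1.isUnit)

theorem rank_conj_sub_one (s y : SpGroup k n) :
    ((s * y * s⁻¹).1.val - 1).rank = (y.1.val - 1).rank := by
  rw [conj_sub_one, rank_mul_SpGroup, rank_SpGroup_mul]

/-- The form `v ↦ f(v, (y - 1) v)` vanishes. -/
def IsHyperbolicType (y : SpGroup k n) : Prop :=
  ∀ v, sympForm k n v ((y.1.val - 1) *ᵥ v) = 0

theorem isHyperbolicType_conj_iff (s y : SpGroup k n) :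
    IsHyperbolicType (s * y * s⁻¹) ↔ IsHyperbolicType y := by
  have h : ∀ s y : SpGroup k n, IsHyperbolicType y → IsHyperbolicType (s * y * s⁻¹) := by
    intro s y hy v
    have hv := hy ((s⁻¹).1.val *ᵥ v)
    rw [← s.2] at hv
    rw [conj_sub_one, ← mulVec_mulVec, ← mulVec_mulVec]
    convert hv
    rw [mulVec_mulVec, ← Units.val_mul, ← Subgroup.coe_mul, mul_inv_cancel]
    exact (one_mulVec v).symm
  refine ⟨fun hy => ?_, h s y⟩
  simpa [mul_assoc] using h s⁻¹ _ hy

theorem sub_one_mul_self_of_sq_eq_one [CharP k 2] {y : SpGroup k n} (hy : y ^ 2 = 1) :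
    (y.1.val - 1) * (y.1.val - 1) = 0 := by
  have : y.1.val * y.1.val = 1 := by
    rw [← Units.val_mul, ← Subgroup.coe_mul, ← sq, hy]; rfl
  rw [sub_mul, mul_sub, this, mul_one, one_mul, ← neg_sub y.1.val 1, neg_of_charTwo, sub_self]

theorem transpose_mul_J_mul_sub_one [CharP k 2] {y : SpGroup k n} (hy : y ^ 2 = 1) :
    (y.1.val - 1)ᵀ * J (Fin n) k * (y.1.val - 1) = 0 ∧
      (J (Fin n) k * (y.1.val - 1)).IsSymm := by
  have hN := sub_one_mul_self_of_sq_eq_one hy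
  have hJ := mem_SpGroup_iff.1 y.2
  obtain ⟨N, hyN⟩ : ∃ N, y.1.val = 1 + N := ⟨y.1.val - 1, by abel⟩
  rw [hyN, add_sub_cancel_left] at hN ⊢
  rw [hyN] at hJ
  have h : Nᵀ * J (Fin n) k + J (Fin n) k * N + Nᵀ * J (Fin n) k * N = 0 := by
    rw [transpose_add, transpose_one] at hJ
    have := sub_eq_zero.2 hJ
    rw [← this]; noncomm_ring
  have h1 : Nᵀ * J (Fin n) k * N = 0 := by
    have := congrArg (· * N) h
    simpa only [add_mul, Matrix.mul_assoc, hN, mul_zero, add_zero, zero_mul] using this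
  refine ⟨h1, ?_⟩
  rw [h1, add_zero] at h
  rw [IsSymm, transpose_mul, J_transpose, mul_neg]
  exact neg_eq_of_add_eq_zero_right h

end Involution

theorem conj_sq_eq_one {G : Type*} [Group G] {s y : G} (hy : y ^ 2 = 1) :
    (s * y * s⁻¹) ^ 2 = 1 := by
  rw [conj_pow, hy, mul_one, mul_inv_cancel]

section NormalForm

open Matrix

variable {k : Type*} [Field k] {n : ℕ}

theorem lowerLeft_eq_toBlocks_sub_one (y : SpGroup k n) :
    lowerLeft y = (y.1.val - 1).toBlocks₂₁ := by
  ext i j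
  simp [lowerLeft, toBlocks₂₁]

theorem lowerLeft_levi_conj (A : GL (Fin n) k) (y : SpGroup k n) :
    lowerLeft (levi A⁻¹ * y * (levi A⁻¹)⁻¹) = A.valᵀ * lowerLeft y * A.val := by
  obtain ⟨a, b, c, d, h⟩ : ∃ a b c d, y.1.val = fromBlocks a b c d :=
    ⟨_, _, _, _, (fromBlocks_toBlocks y.1.val).symm⟩
  have h1 : (levi A⁻¹ : SpGroup k n).1.val = fromBlocks (A⁻¹).val 0 0 A.valᵀ := by
    simp [levi, spOfMatrix, -coe_units_inv]
  have h2 : ((levi A⁻¹ : SpGroup k n)⁻¹).1.val = fromBlocks A.val 0 0 (A⁻¹).valᵀ := by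
    simp [levi, spOfMatrix, Units.inv_mk, -coe_units_inv]
  rw [lowerLeft, lowerLeft, Subgroup.coe_mul, Subgroup.coe_mul, Units.val_mul, Units.val_mul,
    h1, h2, h]
  simp [fromBlocks_multiply]

theorem rank_lowerLeft_le (y : SpGroup k n) : (lowerLeft y).rank ≤ (y.1.val - 1).rank := by
  rw [lowerLeft_eq_toBlocks_sub_one]
  exact rank_submatrix_le _ Sum.inr Sum.inl

variable [CharP k 2] {y : SpGroup k n}

theorem lowerLeft_isSymm (hy : y ^ 2 = 1) : (lowerLeft y).IsSymm := by
  have h := (transpose_mul_J_mul_sub_one hy).2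
  rw [lowerLeft_eq_toBlocks_sub_one]
  obtain ⟨P, Q, R, S, hN⟩ : ∃ P Q R S, y.1.val - 1 = fromBlocks P Q R S :=
    ⟨_, _, _, _, (fromBlocks_toBlocks (y.1.val - 1)).symm⟩
  rw [hN, J, fromBlocks_multiply, isSymm_fromBlocks_iff] at h
  rw [hN]
  simpa [neg_of_charTwo] using! h.1

/-- An involution `y` for which `y - 1` has the same rank as its lower left block `R` is determined
by `R` together with a matrix `Y`. -/
theorem exists_sub_one_eq_fromBlocks (hy : y ^ 2 = 1)
    (hr : (y.1.val - 1).rank ≤ (lowerLeft y).rank) :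
    ∃ Y, y.1.val - 1 =
      fromBlocks (Y * lowerLeft y) (Y * lowerLeft y * Yᵀ) (lowerLeft y) (lowerLeft y * Yᵀ) := by
  have h := (transpose_mul_J_mul_sub_one hy).2
  have hR := lowerLeft_isSymm hy
  rw [lowerLeft_eq_toBlocks_sub_one] at hr hR ⊢
  obtain ⟨P, Q, R, S, hN⟩ : ∃ P Q R S, y.1.val - 1 = fromBlocks P Q R S :=
    ⟨_, _, _, _, (fromBlocks_toBlocks (y.1.val - 1)).symm⟩
  rw [hN, toBlocks_fromBlocks₂₁] at hr hR ⊢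
  rw [hN, J, fromBlocks_multiply, isSymm_fromBlocks_iff] at h
  obtain ⟨-, h1, -, -⟩ := h
  simp only [zero_mul, one_mul, zero_add, neg_of_charTwo, add_zero] at h1
  have hC : fromBlocks P Q R S * fromRows (1 : Matrix (Fin n) (Fin n) k)
      (0 : Matrix (Fin n) (Fin n) k) = fromRows P R := by
    simp [← fromCols_fromRows_eq_fromBlocks, fromCols_mul_fromRows]
  obtain ⟨Z, hZ⟩ := exists_eq_mul_of_rank_le (M := fromBlocks P Q R S)
    (C := fromRows (1 : Matrix (Fin n) (Fin n) k) (0 : Matrix (Fin n) (Fin n) k)) <| by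
    rw [hC]
    exact hr.trans (rank_submatrix_le (fromRows P R) Sum.inr id)
  rw [hC, ← fromCols_toCols Z, fromRows_mul_fromCols, fromBlocks_inj] at hZ
  obtain ⟨-, hQ, -, hS⟩ := hZ
  refine ⟨Z.toCols₂ᵀ, ?_⟩
  have hP : P = Z.toCols₂ᵀ * R := by
    rw [← h1, ← hR.eq, ← transpose_mul, ← hS]
  rw [fromBlocks_inj, ← hP, transpose_transpose]
  exact ⟨rfl, hQ, rfl, hS⟩

theorem isHyperbolicType_iff (hy : y ^ 2 = 1)
    (hr : (y.1.val - 1).rank ≤ (lowerLeft y).rank) :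
    IsHyperbolicType y ↔ ∀ x, (lowerLeft y).toBilin' x x = 0 := by
  obtain ⟨Y, hY⟩ := exists_sub_one_eq_fromBlocks hy hr
  have key : ∀ a b : Fin n → k, sympForm k n (Sum.elim a b) ((y.1.val - 1) *ᵥ Sum.elim a b) =
      (lowerLeft y).toBilin' (a + Yᵀ *ᵥ b) (a + Yᵀ *ᵥ b) := by
    intro a b
    rw [sympForm_eq_dotProduct, hY, toBilin'_apply', J]
    generalize lowerLeft y = R
    set c := a + Yᵀ *ᵥ b with hc
    have h1 : fromBlocks (Y * R) (Y * R * Yᵀ) R (R * Yᵀ) *ᵥ Sum.elim a b =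
        Sum.elim (Y *ᵥ (R *ᵥ c)) (R *ᵥ c) := by
      simp [fromBlocks_mulVec, hc, mulVec_add, ← mulVec_mulVec]
    rw [h1]
    simp only [fromBlocks_mulVec, Sum.elim_comp_inl, Sum.elim_comp_inr, zero_mulVec, zero_add,
      neg_mulVec, one_mulVec, add_zero, sumElim_dotProduct_sumElim, dotProduct_neg]
    rw [hc, add_dotProduct, mulVec_transpose, ← dotProduct_mulVec, CharTwo.neg_eq, CharTwo.neg_eq]
  refine ⟨fun h x => ?_, fun h v => ?_⟩
  · have := key x 0
    rw [h] at this
    simpa using this.symm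
  · rw [← Sum.elim_comp_inl_inr v, key]
    exact h _

theorem conj_lowerUnipotent_eq {Y D : Matrix (Fin n) (Fin n) k} (hD : D.IsSymm)
    (hD3 : D * D * D = D) (hYD : D * Y * D = D * Yᵀ * D)
    (hy : y.1.val - 1 = fromBlocks (Y * D) (Y * D * Yᵀ) D (D * Yᵀ)) :
    ∃ (X : Matrix (Fin n) (Fin n) k) (hX : X.IsSymm),
      y = upperUnipotent X hX * lowerUnipotent D hD * (upperUnipotent X hX)⁻¹ := by
  have hEYE : D * D * Y * (D * D) = D * D * Yᵀ * (D * D) := by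
    have := congrArg (fun M => D * M * D) hYD
    simpa only [Matrix.mul_assoc] using this
  let X := Y * (D * D) + D * D * Yᵀ + D * D * Yᵀ * (D * D)
  have hX : X.IsSymm := by
    simp only [X, IsSymm, transpose_add, transpose_mul, transpose_transpose, hD.eq]
    rw [← Matrix.mul_assoc (D * D), hEYE, add_comm (D * D * Yᵀ)]
  have hXD : X * D = Y * D := by
    have h1 : D * D * Yᵀ * (D * D) * D = D * D * Yᵀ * D := by
      rw [Matrix.mul_assoc _ (D * D), hD3]
    simp only [X, add_mul, h1]
    rw [add_assoc, add_self_of_charTwo, add_zero, Matrix.mul_assoc, hD3]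
  have hDX : D * X = D * Yᵀ := by
    have := congrArg transpose hXD
    rwa [transpose_mul, transpose_mul, hX.eq, hD.eq] at this
  refine ⟨X, hX, ?_⟩
  rw [eq_mul_inv_iff_mul_eq]
  refine Subtype.ext (Units.ext ?_)
  rw [Subgroup.coe_mul, Subgroup.coe_mul, Units.val_mul, Units.val_mul, eq_add_of_sub_eq hy,
    ← fromBlocks_one]
  simp only [upperUnipotent, lowerUnipotent, spOfMatrix, fromBlocks_multiply, fromBlocks_add,
    fromBlocks_inj]
  simp only [Matrix.mul_one, Matrix.one_mul, Matrix.mul_zero, zero_add, add_zero, hXD, hDX]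
  refine ⟨add_comm _ _, ?_, trivial, ?_⟩
  · rw [add_mul, Matrix.one_mul, Matrix.mul_assoc, hDX, ← Matrix.mul_assoc, add_right_comm,
      add_self_of_charTwo, zero_add]
  · rw [← add_assoc, add_self_of_charTwo, zero_add]

/-- Involutions in the big cell are conjugate under the Borel subgroup to a standard one. -/
theorem mem_conjOrbit_of_hasLeadingMinors [IsAlgClosed k] {r : ℕ} {alt : Prop}
    (hy : y ^ 2 = 1) (hyr : (y.1.val - 1).rank = r) (hyalt : IsHyperbolicType y ↔ alt)
    (hσ : ∀ i < r, formPairing alt i < r) (hrn : r ≤ n)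
    (hlead : HasLeadingMinors (formPairing alt) r (lowerLeft y)) :
    y ∈ conjOrbit (spBorel k n) (lowerUnipotent (pairingMatrix k n (formPairing alt) r)
      (pairingMatrix_isSymm (formPairing_involutive alt) hσ)) := by
  have hr : r ≤ (lowerLeft y).rank := le_rank_of_leadingMinor_ne_zero hrn (hlead r le_rfl hσ)
  have hr' : (lowerLeft y).rank = r := (hyr ▸ rank_lowerLeft_le y).antisymm hr
  have halt := (isHyperbolicType_iff hy (hyr.trans_le hr)).symm.trans hyalt
  rw [← hr'] at hlead
  obtain ⟨A, hA, hdet, hAR⟩ :=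
    exists_blockTriangular_congr_pairingMatrix (lowerLeft_isSymm hy) halt hlead
  rw [hr'] at hAR
  set D := pairingMatrix k n (formPairing alt) r
  have hD : D.IsSymm := pairingMatrix_isSymm (formPairing_involutive alt) hσ
  have hD3 : D * D * D = D := pairingMatrix_mul_mul_self (formPairing_involutive alt) hσ hrn
  let B : GL (Fin n) k := GeneralLinearGroup.mkOfDetNeZero A hdet
  let z := levi B⁻¹ * y * (levi B⁻¹)⁻¹
  have hzD : lowerLeft z = D := (lowerLeft_levi_conj B y).trans hAR
  have hz : z ^ 2 = 1 := conj_sq_eq_one hy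
  have hzr : (z.1.val - 1).rank = r := (rank_conj_sub_one _ _).trans hyr
  have hDr : D.rank = r := by
    rw [← hAR, rank_mul_eq_left_of_det_ne_zero _ _ hdet,
      rank_mul_eq_right_of_det_ne_zero _ _ (by rwa [det_transpose]), hr']
  obtain ⟨Y, hY⟩ := exists_sub_one_eq_fromBlocks hz (by rw [hzD, hDr, hzr])
  rw [hzD] at hY
  have hYD : D * Y * D = D * Yᵀ * D := by
    have h0 := sub_one_mul_self_of_sq_eq_one hz
    rw [hY, fromBlocks_multiply, ← fromBlocks_zero, fromBlocks_inj] at h0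
    have h1 := h0.2.2.1
    rw [← Matrix.mul_assoc] at h1
    rw [eq_neg_of_add_eq_zero_left h1, neg_of_charTwo]
  obtain ⟨X, hX, hzX⟩ := conj_lowerUnipotent_eq hD hD3 hYD hY
  refine ⟨(levi B⁻¹)⁻¹ * upperUnipotent X hX, mul_mem (inv_mem (levi_mem_spBorel
    (inv_blockTriangular hA))) (upperUnipotent_mem_spBorel hX), ?_⟩
  have : y = (levi B⁻¹)⁻¹ * z * levi B⁻¹ := by simp only [z]; group
  rw [this, hzX]
  simp only [_root_.mul_inv_rev, inv_inv, mul_assoc]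
  rfl

end NormalForm

section BigCell

open Matrix

variable {k : Type*} [Field k] {n : ℕ}

/-- The elements lying in an irreducible subset containing the identity. -/
def connectedToOne (k : Type*) [Field k] (n : ℕ) : Submonoid (SpGroup k n) where
  carrier := {s | ∃ Z, IsPreirreducible Z ∧ 1 ∈ Z ∧ s ∈ Z}
  one_mem' := ⟨{1}, isPreirreducible_singleton, rfl, rfl⟩
  mul_mem' := by
    rintro s t ⟨Z, hZ, h1, hs⟩ ⟨W, hW, h1', ht⟩
    exact ⟨Z * W, hZ.mul_of_separatelyContinuous hW, ⟨1, h1, 1, h1', mul_one 1⟩,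
      Set.mul_mem_mul hs ht⟩

theorem lowerUnipotent_diagonal_mem_connectedToOne [Infinite k] (d : Fin n → k) :
    lowerUnipotent (diagonal d) (isSymm_diagonal d) ∈ connectedToOne k n := by
  let φ : {x : Fin n → k // MvPolynomial.eval x (1 : MvPolynomial (Fin n) k) ≠ 0} → SpGroup k n :=
    fun x => lowerUnipotent (diagonal x.1) (isSymm_diagonal x.1)
  have hd : ∀ i j, (fun x : {x : Fin n → k // MvPolynomial.eval x (1 : MvPolynomial _ k) ≠ 0} =>
      diagonal x.1 i j) ∈ principalRegular (1 : MvPolynomial (Fin n) k) := by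
    intro i j
    by_cases h : i = j
    · subst h
      simpa using! coord_mem_principalRegular 1 i
    · simp only [diagonal_apply_ne _ h]
      exact zero_mem _
  have hc : ∀ (M : Matrix (Fin n) (Fin n) k) (i j),
      (fun _ => M i j) ∈ principalRegular (1 : MvPolynomial (Fin n) k) :=
    fun M i j => (principalRegular _).algebraMap_mem (M i j)
  refine ⟨Set.range φ, isPreirreducible_range_gl _
    (principalRegular_mul_ne_zero one_ne_zero) ?_ ?_, ⟨⟨0, by simp⟩, ?_⟩, ⟨⟨d, by simp⟩, rfl⟩⟩
  · exact fromBlocks_entry_mem _ (hc 1) (hc 0) hd (hc 1)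
  · exact fromBlocks_entry_mem _ (hc 1) (hc 0) (fun i j => neg_mem (hd i j)) (hc 1)
  · refine Subtype.ext (Units.ext ?_)
    simp [φ, lowerUnipotent, spOfMatrix]

theorem levi_mem_connectedToOne [Infinite k] (A : GL (Fin n) k) : levi A ∈ connectedToOne k n := by
  let p : MvPolynomial (Fin n × Fin n) k := (mvPolynomialX (Fin n) (Fin n) k).det
  have hp : p ≠ 0 := det_mvPolynomialX_ne_zero _ _
  have hdet : ∀ x : Fin n × Fin n → k, (of fun i j => x (i, j)).det = MvPolynomial.eval x p := by
    intro x
    rw [RingHom.map_det]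
    congr 1
    ext i j
    simp [mvPolynomialX]
  let B : {x // MvPolynomial.eval x p ≠ 0} → GL (Fin n) k := fun x =>
    GeneralLinearGroup.mkOfDetNeZero (of fun i j => x.1 (i, j)) (by rw [hdet]; exact x.2)
  have hB : ∀ i j, (fun x => (B x).val i j) ∈ principalRegular p :=
    fun i j => coord_mem_principalRegular p (i, j)
  have hB' : ∀ i j, (fun x => (B x)⁻¹.val i j) ∈ principalRegular p := by
    intro i j
    simp only [coe_units_inv]
    refine inv_entry_mem _ hB ?_ i j
    convert inv_mem_principalRegular p using 2 with x
    exact congrArg _ (hdet x.1)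
  have hsurj : ∀ A : GL (Fin n) k, ∃ x, B x = A := fun A =>
    ⟨⟨fun q => A.val q.1 q.2, by
      rw [← hdet]; exact ((isUnit_iff_isUnit_det _).1 A.isUnit).ne_zero⟩, Units.ext rfl⟩
  refine ⟨Set.range fun x => levi (B x), isPreirreducible_range_gl _
    (principalRegular_mul_ne_zero hp) ?_ ?_, ?_, ?_⟩
  · exact fromBlocks_entry_mem _ hB (fun _ _ => zero_mem _) (fun _ _ => zero_mem _)
      fun i j => hB' j i
  · exact fromBlocks_entry_mem _ hB' (fun _ _ => zero_mem _) (fun _ _ => zero_mem _)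
      fun i j => hB j i
  · obtain ⟨x, hx⟩ := hsurj 1
    refine ⟨x, Subtype.ext (Units.ext ?_)⟩
    simp [hx, levi, spOfMatrix]
  · obtain ⟨x, hx⟩ := hsurj A
    exact ⟨x, congrArg levi hx⟩

theorem isOpen_hasLeadingMinors (σ : ℕ → ℕ) (r : ℕ) :
    IsOpen {y : SpGroup k n | HasLeadingMinors σ r (lowerLeft y)} := by
  have : {y : SpGroup k n | HasLeadingMinors σ r (lowerLeft y)} =
      ⋂ t ∈ {t | t ≤ r ∧ ∀ i < t, σ i < t}, {y | leadingMinor t (lowerLeft y) ≠ 0} := by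
    ext y
    simp [HasLeadingMinors]
  rw [this]
  refine ((Set.finite_Iic r).subset fun t ht => ht.1).isOpen_biInter fun t _ => ?_
  exact (isOpen_of_mem_glRegular (det_mem (glRegular _ k) fun (i j : {i : Fin n // (i : ℕ) < t}) =>
    entry_mem_glRegular (Sum.inr i.1) (Sum.inl j.1))).preimage continuous_subtype_val

theorem exists_levi_conj_hasLeadingMinors [CharP k 2] [IsAlgClosed k] {y : SpGroup k n}
    (hy : y ^ 2 = 1) {r : ℕ} {alt : Prop} (hyr : (y.1.val - 1).rank = r)
    (hyalt : IsHyperbolicType y ↔ alt) (hr : (y.1.val - 1).rank ≤ (lowerLeft y).rank) :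
    ∃ A, HasLeadingMinors (formPairing alt) r (lowerLeft (levi A * y * (levi A)⁻¹)) := by
  obtain ⟨A, hA, h⟩ := exists_hasLeadingMinors (lowerLeft_isSymm hy)
    ((isHyperbolicType_iff hy hr).symm.trans hyalt)
  refine ⟨(GeneralLinearGroup.mkOfDetNeZero A hA)⁻¹, ?_⟩
  rw [lowerLeft_levi_conj]
  rwa [(rank_lowerLeft_le y).antisymm hr, hyr] at h

/-- The lower half of `s (y - 1)`. -/
def lowerHalf (s y : SpGroup k n) : Matrix (Fin n) (Fin n ⊕ Fin n) k :=
  (s.1.val * (y.1.val - 1)).toRows₂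

theorem lowerHalf_mulVec (s y : SpGroup k n) (v : Fin n ⊕ Fin n → k) :
    lowerHalf s y *ᵥ v = (s.1.val *ᵥ ((y.1.val - 1) *ᵥ v)) ∘ Sum.inr := by
  rw [mulVec_mulVec]
  rfl

theorem rank_sub_one_le_rank_lowerLeft [CharP k 2] {y s : SpGroup k n} (hy : y ^ 2 = 1)
    (h : (y.1.val - 1).rank ≤ (lowerHalf s y).rank) :
    ((s * y * s⁻¹).1.val - 1).rank ≤ (lowerLeft (s * y * s⁻¹)).rank := by
  have hrank : (lowerHalf s y * (s⁻¹).1.val).rank = (lowerHalf s y).rank := rank_mul_SpGroup _ _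
  have hrows : lowerHalf s y * (s⁻¹).1.val = ((s * y * s⁻¹).1.val - 1).toRows₂ := by
    rw [conj_sub_one]
    rfl
  rw [← rank_conj_sub_one s, ← hrank, hrows] at h
  have hR := lowerLeft_isSymm (conj_sq_eq_one (s := s) hy)
  have hJ := (transpose_mul_J_mul_sub_one (conj_sq_eq_one (s := s) hy)).2
  rw [lowerLeft_eq_toBlocks_sub_one] at hR ⊢
  generalize (s * y * s⁻¹).1.val - 1 = N at *
  obtain ⟨P, Q, R, S, rfl⟩ : ∃ P Q R S, N = fromBlocks P Q R S :=
    ⟨_, _, _, _, (fromBlocks_toBlocks N).symm⟩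
  rw [toBlocks_fromBlocks₂₁] at hR ⊢
  rw [J, fromBlocks_multiply, isSymm_fromBlocks_iff] at hJ
  obtain ⟨-, hSP, -, -⟩ := hJ
  simp only [zero_mul, one_mul, zero_add, neg_of_charTwo, add_zero] at hSP
  have hC : fromBlocks P Q R S * fromRows (1 : Matrix (Fin n) (Fin n) k)
      (0 : Matrix (Fin n) (Fin n) k) = fromRows P R := by
    simp [← fromCols_fromRows_eq_fromBlocks, fromCols_mul_fromRows]
  have hrC : (fromBlocks P Q R S).toRows₂.rank ≤ (fromRows P R).rank := by
    have : (fromBlocks P Q R S).toRows₂ = (fromCols S R).submatrix id Sum.swap := by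
      ext i (j | j) <;> rfl
    rw [← rank_transpose (fromRows P R), transpose_fromRows, hR.eq, this,
      show Pᵀ = S by rw [← hSP, transpose_transpose]]
    exact rank_submatrix_le _ _ _
  obtain ⟨Z, hZ⟩ := exists_eq_mul_of_rank_le (M := fromBlocks P Q R S)
    (C := fromRows (1 : Matrix (Fin n) (Fin n) k) (0 : Matrix (Fin n) (Fin n) k)) <| by
    rw [hC]
    exact h.trans hrC
  rw [hC, fromRows_mul] at hZ
  have h2 : (fromBlocks P Q R S).toRows₂ = R * Z := by
    rw [hZ, toRows₂_fromRows]
  exact h.trans (h2 ▸ rank_mul_le_left R Z)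

theorem exists_rank_lowerHalf_lt [CharP k 2] [Infinite k] {y s : SpGroup k n} (hy : y ^ 2 = 1)
    (h : (lowerHalf s y).rank < (y.1.val - 1).rank) :
    ∃ t ∈ connectedToOne k n, (lowerHalf s y).rank < (lowerHalf (t * s) y).rank := by
  have hnull : ∀ {m : Type} [Fintype m] (M : Matrix m (Fin n ⊕ Fin n) k),
      M.rank + Module.finrank k (LinearMap.ker M.mulVecLin) =
        Module.finrank k (Fin n ⊕ Fin n → k) :=
    fun M => M.mulVecLin.finrank_range_add_finrank_ker
  obtain ⟨z, hz, hNz⟩ : ∃ z, lowerHalf s y *ᵥ z = 0 ∧ (y.1.val - 1) *ᵥ z ≠ 0 := by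
    by_contra! hall
    have hle : LinearMap.ker (lowerHalf s y).mulVecLin ≤
        LinearMap.ker (y.1.val - 1).mulVecLin := fun z hz => hall z hz
    have := Submodule.finrank_mono hle
    have h1 := hnull (lowerHalf s y)
    have h2 := hnull (y.1.val - 1)
    omega
  rw [lowerHalf_mulVec] at hz
  set w := s.1.val *ᵥ ((y.1.val - 1) *ᵥ z) with hw
  obtain ⟨i, hi⟩ : ∃ i, w (Sum.inl i) ≠ 0 := by
    by_contra! hall
    have hw0 : w = 0 := by
      ext (i | i)
      · exact hall i
      · exact congrFun hz i
    refine hNz ?_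
    have := congrArg ((s⁻¹).1.val *ᵥ ·) (hw.symm.trans hw0)
    simpa only [mulVec_mulVec, mulVec_zero, ← Matrix.mul_assoc, ← Units.val_mul,
      ← Subgroup.coe_mul, inv_mul_cancel, OneMemClass.coe_one, Units.val_one, Matrix.one_mul]
      using this
  have hiso : ∀ z', w ⬝ᵥ J (Fin n) k *ᵥ (s.1.val *ᵥ ((y.1.val - 1) *ᵥ z')) = 0 := by
    intro z'
    rw [← neg_eq_zero, ← sympForm_eq_dotProduct, hw, s.2, sympForm_eq_dotProduct, neg_eq_zero,
      ← vecMul_transpose, ← dotProduct_mulVec, mulVec_mulVec, mulVec_mulVec,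
      (transpose_mul_J_mul_sub_one hy).1, zero_mulVec, dotProduct_zero]
  let d : Fin n → k := Pi.single i 1
  have ht : ∀ v, lowerHalf (lowerUnipotent (diagonal d) (isSymm_diagonal d) * s) y *ᵥ v =
      diagonal d *ᵥ ((s.1.val *ᵥ ((y.1.val - 1) *ᵥ v)) ∘ Sum.inl) +
        (s.1.val *ᵥ ((y.1.val - 1) *ᵥ v)) ∘ Sum.inr := by
    intro v
    rw [lowerHalf_mulVec, Subgroup.coe_mul, Units.val_mul, ← mulVec_mulVec]
    generalize s.1.val *ᵥ ((y.1.val - 1) *ᵥ v) = w'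
    simp [lowerUnipotent, spOfMatrix, fromBlocks_mulVec]
  refine ⟨_, lowerUnipotent_diagonal_mem_connectedToOne d, ?_⟩
  have hlt : LinearMap.ker (lowerHalf
      (lowerUnipotent (diagonal d) (isSymm_diagonal d) * s) y).mulVecLin <
      LinearMap.ker (lowerHalf s y).mulVecLin := by
    refine SetLike.lt_iff_le_and_exists.2 ⟨fun z' hz' => ?_, z, ?_, fun hz' => hi ?_⟩
    · rw [LinearMap.mem_ker, mulVecLin_apply, ht] at hz'
      rw [LinearMap.mem_ker, mulVecLin_apply, lowerHalf_mulVec]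
      have := hiso z'
      generalize s.1.val *ᵥ ((y.1.val - 1) *ᵥ z') = w' at *
      have hw' : ∀ j, j ≠ i → w' (Sum.inr j) = 0 := fun j hj => by
        simpa [d, mulVec_diagonal, hj] using congrFun hz' j
      have hwi : w (Sum.inl i) * w' (Sum.inr i) = 0 := by
        have hsum : sympForm k n w w' = w (Sum.inl i) * w' (Sum.inr i) := by
          rw [sympForm, Finset.sum_eq_single i (fun j _ hj => ?_) (by simp)]
          · simp [show w (Sum.inr i) = 0 from congrFun hz i]
          · simp [hw' j hj, show w (Sum.inr j) = 0 from congrFun hz j]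
        rw [← hsum, sympForm_eq_dotProduct, this, neg_zero]
      ext j
      rcases eq_or_ne j i with rfl | hj
      · exact (mul_eq_zero.1 hwi).resolve_left hi
      · exact hw' j hj
    · exact (lowerHalf_mulVec s y z).trans hz
    · have := (ht z).symm.trans hz'
      rw [← hw, hz, add_zero] at this
      simpa [d, mulVec_diagonal] using congrFun this i
  have := Submodule.finrank_lt_finrank_of_lt hlt
  have h1 := hnull (lowerHalf s y)
  have h2 := hnull (lowerHalf (lowerUnipotent (diagonal d) (isSymm_diagonal d) * s) y)
  omega

theorem exists_conj_rank_le [CharP k 2] [Infinite k] {y : SpGroup k n} (hy : y ^ 2 = 1) :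
    ∃ s ∈ connectedToOne k n,
      ((s * y * s⁻¹).1.val - 1).rank ≤ (lowerLeft (s * y * s⁻¹)).rank := by
  have key : ∀ d : ℕ, ∀ s ∈ connectedToOne k n,
      (y.1.val - 1).rank ≤ (lowerHalf s y).rank + d →
      ∃ s ∈ connectedToOne k n, (y.1.val - 1).rank ≤ (lowerHalf s y).rank := by
    intro d
    induction d with
    | zero => exact fun s hs h => ⟨s, hs, h⟩
    | succ d ih =>
      intro s hs h
      rcases le_or_gt (y.1.val - 1).rank (lowerHalf s y).rank with h' | h'
      · exact ⟨s, hs, h'⟩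
      · obtain ⟨t, ht, hlt⟩ := exists_rank_lowerHalf_lt hy h'
        exact ih (t * s) (mul_mem ht hs) (by omega)
  obtain ⟨s, hs, h⟩ := key _ 1 (one_mem _) (Nat.le_add_left _ _)
  exact ⟨s, hs, rank_sub_one_le_rank_lowerLeft hy h⟩

theorem exists_conj_hasLeadingMinors [CharP k 2] [IsAlgClosed k] {y : SpGroup k n}
    (hy : y ^ 2 = 1) {r : ℕ} {alt : Prop} (hyr : (y.1.val - 1).rank = r)
    (hyalt : IsHyperbolicType y ↔ alt) :
    ∃ s ∈ connectedToOne k n, (∀ i < r, formPairing alt i < r) ∧ r ≤ n ∧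
      HasLeadingMinors (formPairing alt) r (lowerLeft (s * y * s⁻¹)) := by
  have := IsAlgClosed.instInfinite (K := k)
  obtain ⟨s, hs, h⟩ := exists_conj_rank_le hy
  have hz := conj_sq_eq_one (s := s) hy
  have hzr := (rank_conj_sub_one s y).trans hyr
  have hzalt := (isHyperbolicType_conj_iff s y).trans hyalt
  have hr := (h.antisymm (rank_lowerLeft_le _)).symm.trans hzr
  obtain ⟨A, hA⟩ := exists_levi_conj_hasLeadingMinors hz hzr hzalt h
  refine ⟨levi A * s, mul_mem (levi_mem_connectedToOne A) hs, ?_, ?_, ?_⟩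
  · rw [← hr]
    exact (exists_isGramPattern (lowerLeft_isSymm hz)
      ((isHyperbolicType_iff hz h).symm.trans hzalt)).1
  · exact hr ▸ rank_le_height _
  · rwa [_root_.mul_inv_rev, mul_assoc (levi A), mul_assoc (levi A), ← mul_assoc _ s⁻¹,
      ← mul_assoc (levi A)]

end BigCell

/-- Let `k` be an algebraically closed field of characteristic 2 and let
`G = Sp(2n, k)` with `n ≥ 2`. Then the conjugacy class of every involution of `G`
(every element `u ≠ 1` with `u² = 1`) is spherical. -/
theorem spherical_of_involution_symplectic_char_two
    (k : Type*) [Field k] [IsAlgClosed k] (hchar : ringChar k = 2)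
    (n : ℕ) (hn : 2 ≤ n)
    (u : SpGroup k n) (hu : u ≠ 1) (hu2 : u ^ 2 = 1) :
    IsSphericalClass (SpGroup k n) (conjClass u) := by
  have : CharP k 2 := ringChar.of_eq hchar
  have := IsAlgClosed.instInfinite (K := k)
  obtain ⟨s, -, hσ, hrn, hs⟩ := exists_conj_hasLeadingMinors hu2 rfl Iff.rfl
  obtain ⟨b, -, hb⟩ := mem_conjOrbit_of_hasLeadingMinors (conj_sq_eq_one hu2)
    (rank_conj_sub_one s u) (isHyperbolicType_conj_iff s u) hσ hrn hs
  refine isSphericalClass_of_dense_conjOrbit isClosed_spBorel isConnected_spBorel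
    isSolvable_spBorel ((isConj_iff.2 ⟨s, hb⟩).trans (isConj_iff.2 ⟨b, rfl⟩).symm) ?_
  intro v hv
  obtain ⟨c, rfl⟩ := isConj_iff.1 hv
  have hc2 := conj_sq_eq_one (s := c) hu2
  have hcr := rank_conj_sub_one c u
  have hcalt := isHyperbolicType_conj_iff c u
  obtain ⟨t, ⟨Z, hZ, h1, ht⟩, -, -, hlead⟩ := exists_conj_hasLeadingMinors hc2 hcr hcalt
  refine mem_closure_of_conj_mem hZ h1 (isOpen_hasLeadingMinors _ _) (fun t ht => ?_) ht hlead
  exact mem_conjOrbit_of_hasLeadingMinors (conj_sq_eq_one hc2) ((rank_conj_sub_one t _).trans hcr)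
    ((isHyperbolicType_conj_iff t _).trans hcalt) hσ hrn ht
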